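/- Let n ≥ 1, 0 < α < n, 1 < p < n/α, and let q be defined by 1/p − 1/q = α/n, and let w be a weight on ℝⁿ. Then there exists a constant C > 0 such that ‖w·M_α f‖_{L^{q,∞}} ≤ C·‖f‖_{L^p(w^p)} for every f ∈ L^p(w^p) if and only if w ∈ A_{p,q}^*. -/

import Mathlib

open MeasureTheory Set
open scoped ENNReal

noncomputable section

/-- An axis-parallel cube in `ℝⁿ` (realized as `Fin n → ℝ`) with positive finite side length. -/
def IsCube (n : ℕ) (Q : Set (Fin n → ℝ)) : Prop :=
  ∃ (a : Fin n → ℝ) (h : ℝ), 0 < h ∧ Q = Set.univ.pi fun i => Set.Icc (a i) (a i + h)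

/-- The weak `L^p` quasinorm `sup_{t>0} t · |{x : g x > t}|^{1/p}` of an `ℝ≥0∞`-valued
function on `ℝⁿ`. -/
def wnormE (n : ℕ) (p : ℝ) (g : (Fin n → ℝ) → ℝ≥0∞) : ℝ≥0∞ :=
  ⨆ (t : ℝ) (_ : 0 < t), ENNReal.ofReal t * volume {x | ENNReal.ofReal t < g x} ^ (1 / p)

/-- The Hardy–Littlewood maximal operator: supremum of averages of `|f|` over cubes
containing `x`. -/
def maximalFn (n : ℕ) (f : (Fin n → ℝ) → ℝ) (x : Fin n → ℝ) : ℝ≥0∞ :=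
  ⨆ (Q : Set (Fin n → ℝ)) (_ : IsCube n Q) (_ : x ∈ Q),
    (volume Q)⁻¹ * ∫⁻ y in Q, ENNReal.ofReal |f y|

/-- The fractional maximal operator `M_α`. -/
def fracMaximalFn (n : ℕ) (α : ℝ) (f : (Fin n → ℝ) → ℝ) (x : Fin n → ℝ) : ℝ≥0∞ :=
  ⨆ (Q : Set (Fin n → ℝ)) (_ : IsCube n Q) (_ : x ∈ Q),
    volume Q ^ (α / (n : ℝ)) * ((volume Q)⁻¹ * ∫⁻ y in Q, ENNReal.ofReal |f y|)

/-- The multiplier `A_p^*` characteristic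
`[w]_{A_p^*} = sup_Q (|Q|⁻¹·‖w·χ_Q‖_{L^{1,∞}})·(⨍_Q w^{1-p'})^{p-1}`, with `p' = p/(p-1)`. -/
def ApStarConst (n : ℕ) (p : ℝ) (w : (Fin n → ℝ) → ℝ) : ℝ≥0∞ :=
  ⨆ (Q : Set (Fin n → ℝ)) (_ : IsCube n Q),
    (volume Q)⁻¹ * wnormE n 1 (Q.indicator fun x => ENNReal.ofReal (w x)) *
      ((volume Q)⁻¹ * ∫⁻ x in Q, ENNReal.ofReal (w x ^ (1 - p / (p - 1)))) ^ (p - 1)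

/-- The multiplier `A_{p,q}^*` characteristic
`[w]_{A_{p,q}^*} = sup_Q (|Q|⁻¹·‖w^q·χ_Q‖_{L^{1,∞}})^{1/q}·(⨍_Q w^{-p'})^{1/p'}`,
with `p' = p/(p-1)` and `1/p' = 1 - 1/p`. -/
def ApqStarConst (n : ℕ) (p q : ℝ) (w : (Fin n → ℝ) → ℝ) : ℝ≥0∞ :=
  ⨆ (Q : Set (Fin n → ℝ)) (_ : IsCube n Q),
    ((volume Q)⁻¹ * wnormE n 1 (Q.indicator fun x => ENNReal.ofReal (w x ^ q))) ^ (1 / q) *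
      ((volume Q)⁻¹ * ∫⁻ x in Q, ENNReal.ofReal (w x ^ (-(p / (p - 1))))) ^ (1 - 1 / p)

/-- The Muckenhoupt `A_p` characteristic `[w]_{A_p} = sup_Q (⨍_Q w)·(⨍_Q w^{1-p'})^{p-1}`. -/
def ApConst (n : ℕ) (p : ℝ) (w : (Fin n → ℝ) → ℝ) : ℝ≥0∞ :=
  ⨆ (Q : Set (Fin n → ℝ)) (_ : IsCube n Q),
    ((volume Q)⁻¹ * ∫⁻ x in Q, ENNReal.ofReal (w x)) *
      ((volume Q)⁻¹ * ∫⁻ x in Q, ENNReal.ofReal (w x ^ (1 - p / (p - 1)))) ^ (p - 1)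

/-- The Muckenhoupt `A_{p,q}` characteristic
`[w]_{A_{p,q}} = sup_Q (⨍_Q w^q)^{1/q}·(⨍_Q w^{-p'})^{1/p'}`. -/
def ApqConst (n : ℕ) (p q : ℝ) (w : (Fin n → ℝ) → ℝ) : ℝ≥0∞ :=
  ⨆ (Q : Set (Fin n → ℝ)) (_ : IsCube n Q),
    ((volume Q)⁻¹ * ∫⁻ x in Q, ENNReal.ofReal (w x ^ q)) ^ (1 / q) *
      ((volume Q)⁻¹ * ∫⁻ x in Q, ENNReal.ofReal (w x ^ (-(p / (p - 1))))) ^ (1 - 1 / p)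

/-- Vitali covering bound for a (possibly infinite) family of balls with bounded radii. -/
lemma vit_weak {n : ℕ} {ι : Type*} (σ : Measure (Fin n → ℝ)) (D : ℝ≥0∞)
    (hD : ∀ c r, 0 < r → σ (Metric.closedBall c (5 * r)) ≤ D * σ (Metric.closedBall c r))
    (T : Set ι) (c : ι → Fin n → ℝ) (r : ι → ℝ) (R : ℝ) (hR : ∀ i ∈ T, r i ≤ R)
    (hr : ∀ i ∈ T, 0 < r i) (h : (Fin n → ℝ) → ℝ≥0∞) (l : ℝ≥0∞)
    (hl : ∀ i ∈ T, l * σ (Metric.closedBall (c i) (r i)) ≤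
      ∫⁻ y in Metric.closedBall (c i) (r i), h y ∂σ) :
    l * σ (⋃ i ∈ T, Metric.closedBall (c i) (r i)) ≤ D * ∫⁻ y, h y ∂σ := by
  obtain ⟨u, huT, hdisj, hcov⟩ :=
    Vitali.exists_disjoint_subfamily_covering_enlargement_closedBall T c r R hR 5 (by norm_num)
  have hcount : u.Countable := by
    refine hdisj.countable_of_nonempty_interior fun i hi => ?_
    refine ⟨c i, ?_⟩
    exact Metric.ball_subset_interior_closedBall (Metric.mem_ball_self (hr i (huT hi)))
  have : Countable u := hcount.to_subtype
  have h1 : (⋃ i ∈ T, Metric.closedBall (c i) (r i)) ⊆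
      ⋃ i ∈ u, Metric.closedBall (c i) (5 * r i) := by
    refine iUnion₂_subset fun i hi => ?_
    obtain ⟨b, hb, hsub⟩ := hcov i hi
    exact hsub.trans (subset_biUnion_of_mem (u := fun i => Metric.closedBall (c i) (5 * r i)) hb)
  calc l * σ (⋃ i ∈ T, Metric.closedBall (c i) (r i))
      ≤ l * ∑' i : u, σ (Metric.closedBall (c i) (5 * r i)) := by
        gcongr
        exact (measure_mono h1).trans (measure_biUnion_le σ hcount _)
    _ ≤ l * ∑' i : u, D * σ (Metric.closedBall (c i) (r i)) := by
        gcongr with i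
        exact hD _ _ (hr _ (huT i.2))
    _ = D * ∑' i : u, l * σ (Metric.closedBall (c i) (r i)) := by
        rw [ENNReal.tsum_mul_left, ENNReal.tsum_mul_left]; ring
    _ ≤ D * ∑' i : u, ∫⁻ y in Metric.closedBall (c i) (r i), h y ∂σ := by
        gcongr with i
        exact hl _ (huT i.2)
    _ = D * ∫⁻ y in ⋃ i ∈ u, Metric.closedBall (c i) (r i), h y ∂σ := by
        rw [lintegral_biUnion hcount (fun i _ => Metric.isClosed_closedBall.measurableSet) hdisj]
    _ ≤ D * ∫⁻ y, h y ∂σ := by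
        gcongr
        exact Measure.restrict_le_self

/-- Interpolation: a level-set inequality gives a strong bound. -/
lemma strong_of_weak {X : Type*} [MeasurableSpace X] (σ : Measure X) [SFinite σ] (p : ℝ) (hp : 1 < p)
    (D : ℝ≥0∞)
    (M : X → ℝ≥0∞) (hM : Measurable M) (hMtop : ∀ x, M x ≠ ∞)
    (g : X → ℝ≥0∞) (hg : Measurable g)
    (h : ∀ t : ℝ, 0 < t → ENNReal.ofReal t * σ {x | ENNReal.ofReal t < M x} ≤
      D * ∫⁻ y in {y | ENNReal.ofReal t < 2 * g y}, g y ∂σ) :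
    ∫⁻ x, M x ^ p ∂σ ≤ (ENNReal.ofReal p * D * 2 ^ (p - 1) * ENNReal.ofReal (1 / (p - 1))) *
      ∫⁻ x, g x ^ p ∂σ := by
  have e1 : ∀ x, M x ^ p = ENNReal.ofReal ((M x).toReal ^ p) := by
    intro x
    rw [← ENNReal.ofReal_rpow_of_nonneg ENNReal.toReal_nonneg (by linarith),
      ENNReal.ofReal_toReal (hMtop x)]
  simp_rw [e1]
  rw [lintegral_rpow_eq_lintegral_meas_lt_mul σ (Filter.Eventually.of_forall fun x =>
    ENNReal.toReal_nonneg) hM.ennreal_toReal.aemeasurable (by linarith)]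
  have e2 : ∀ a : ℝ≥0∞, ∫⁻ t in Ioi (0:ℝ), (if ENNReal.ofReal t < 2 * a then a else 0) *
      ENNReal.ofReal (t ^ (p - 2)) ≤ 2 ^ (p - 1) * ENNReal.ofReal (1 / (p - 1)) * a ^ p := by
    intro a
    rcases eq_or_ne a ∞ with rfl | ha
    · have h0 : (2:ℝ≥0∞) ^ (p - 1) * ENNReal.ofReal (1 / (p - 1)) ≠ 0 := by
        refine mul_ne_zero (by simp) ?_
        have : 0 < 1 / (p - 1) := by apply one_div_pos.2; linarith
        simpa using this
      rw [ENNReal.top_rpow_of_pos (by linarith), ENNReal.mul_top h0]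
      exact le_top
    · lift a to NNReal using ha
      rcases eq_or_ne a 0 with rfl | ha0
      · simp
      have hapos : (0:ℝ) < a := by positivity
      have : ∀ t ∈ Ioi (0:ℝ), (if ENNReal.ofReal t < 2 * (a:ℝ≥0∞) then (a:ℝ≥0∞) else 0) *
          ENNReal.ofReal (t ^ (p - 2)) =
          (Ioo (0:ℝ) (2 * a)).indicator (fun t => a * ENNReal.ofReal (t ^ (p - 2))) t := by
        intro t ht
        have hiff : ENNReal.ofReal t < 2 * (a:ℝ≥0∞) ↔ t < 2 * a := by
          have : (2 * (a:ℝ≥0∞)) = ENNReal.ofReal (2 * a) := by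
            rw [ENNReal.ofReal_mul (by norm_num)]; simp
          rw [this, ENNReal.ofReal_lt_ofReal_iff (by positivity)]
        by_cases hta : t < 2 * a
        · rw [if_pos (hiff.2 hta), indicator_of_mem (show t ∈ Ioo (0:ℝ) (2 * a) from ⟨ht, hta⟩)]
        · rw [if_neg (fun h => hta (hiff.1 h)), indicator_of_notMem (fun h => hta h.2), zero_mul]
      rw [setLIntegral_congr_fun measurableSet_Ioi this, lintegral_indicator measurableSet_Ioo,
        Measure.restrict_restrict measurableSet_Ioo,
        show Ioo (0:ℝ) (2 * a) ∩ Ioi 0 = Ioo (0:ℝ) (2 * a) by ext; simp; tauto,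
        lintegral_const_mul _ (by fun_prop)]
      have hIntv : IntervalIntegrable (fun t : ℝ => t ^ (p - 2)) volume 0 (2 * a) :=
        intervalIntegral.intervalIntegrable_rpow' (by linarith)
      have h3 : ∫⁻ t in Ioo (0:ℝ) (2 * a), ENNReal.ofReal (t ^ (p - 2)) =
          ENNReal.ofReal ((2 * a) ^ (p - 1) / (p - 1)) := by
        rw [← ofReal_integral_eq_lintegral_ofReal]
        · rw [← integral_Ioc_eq_integral_Ioo, ← intervalIntegral.integral_of_le (by positivity),
            integral_rpow (Or.inl (by linarith)), show p - 2 + 1 = p - 1 by ring,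
            Real.zero_rpow (by linarith), sub_zero]
        · rw [intervalIntegrable_iff_integrableOn_Ioo_of_le (by positivity)] at hIntv
          exact hIntv
        · filter_upwards [self_mem_ae_restrict measurableSet_Ioo] with t ht
          exact Real.rpow_nonneg ht.1.le _
      rw [h3, div_eq_mul_one_div, ENNReal.ofReal_mul (by positivity), ← ENNReal.ofReal_rpow_of_pos (by positivity),
        ENNReal.ofReal_mul (by norm_num), ENNReal.mul_rpow_of_nonneg _ _ (by linarith)]
      simp only [ENNReal.ofReal_ofNat, ENNReal.ofReal_coe_nnreal]
      have h4 : (a:ℝ≥0∞) ^ p = a * (a:ℝ≥0∞) ^ (p - 1) := by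
        conv_lhs => rw [show p = 1 + (p - 1) by ring]
        rw [ENNReal.rpow_add _ _ (by simpa using ha0) (by simp), ENNReal.rpow_one]
      rw [h4]
      apply le_of_eq; ring
  have e3 : ∫⁻ t in Ioi (0:ℝ), σ {x | t < (M x).toReal} * ENNReal.ofReal (t ^ (p - 1)) ≤
      ∫⁻ t in Ioi (0:ℝ), D * ∫⁻ x, (if ENNReal.ofReal t < 2 * g x then g x else 0) *
        ENNReal.ofReal (t ^ (p - 2)) ∂σ := by
    refine setLIntegral_mono' measurableSet_Ioi fun t ht => ?_
    have ht' : (0:ℝ) < t := ht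
    have s1 : {x | t < (M x).toReal} = {x | ENNReal.ofReal t < M x} := by
      ext x; simp only [mem_ofPred_eq]
      rw [ENNReal.ofReal_lt_iff_lt_toReal ht'.le (hMtop x)]
    have s2 : ENNReal.ofReal (t ^ (p - 1)) = ENNReal.ofReal t * ENNReal.ofReal (t ^ (p - 2)) := by
      rw [← ENNReal.ofReal_mul ht'.le]
      congr 1
      rw [show p - 1 = 1 + (p - 2) by ring, Real.rpow_add ht', Real.rpow_one]
    have hset : MeasurableSet {y | ENNReal.ofReal t < 2 * g y} :=
      measurableSet_lt measurable_const (by fun_prop)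
    rw [s1, s2, lintegral_mul_const' _ _ ENNReal.ofReal_ne_top]
    calc _ = (ENNReal.ofReal t * σ {x | ENNReal.ofReal t < M x}) * ENNReal.ofReal (t ^ (p - 2)) := by ring
      _ ≤ (D * ∫⁻ y in {y | ENNReal.ofReal t < 2 * g y}, g y ∂σ) * ENNReal.ofReal (t ^ (p - 2)) := by
          exact mul_le_mul_left (h t ht') _
      _ = _ := by
          rw [← lintegral_indicator hset, mul_assoc]
          congr 2
          refine lintegral_congr fun x => ?_
          simp [indicator_apply]
  have hmeas : Measurable (Function.uncurry fun (t:ℝ) (x : X) =>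
      (if ENNReal.ofReal t < 2 * g x then g x else 0) * ENNReal.ofReal (t ^ (p - 2))) := by
    refine Measurable.mul (Measurable.ite (measurableSet_lt (by fun_prop) (by fun_prop)) (by fun_prop) measurable_const) ?_
    fun_prop
  calc _ ≤ ENNReal.ofReal p * (D * ∫⁻ x, 2 ^ (p - 1) * ENNReal.ofReal (1 / (p - 1)) * g x ^ p ∂σ) := by
        gcongr
        refine e3.trans ?_
        have hm2 := hmeas.lintegral_prod_right' (ν := σ)
        simp only [Function.uncurry_apply_pair] at hm2
        rw [lintegral_const_mul _ hm2]
        gcongr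
        rw [lintegral_lintegral_swap hmeas.aemeasurable]
        exact lintegral_mono fun x => e2 _
    _ = _ := by
        rw [lintegral_const_mul _ (by fun_prop)]
        ring

/-- Carleson-type embedding for finite families with bounded overlap. -/
lemma fin_embed {n : ℕ} {ι : Type*} (σ : Measure (Fin n → ℝ)) [SFinite σ] (p : ℝ) (hp : 1 < p)
    (D : ℝ≥0∞)
    (hD : ∀ c r, 0 < r → σ (Metric.closedBall c (5 * r)) ≤ D * σ (Metric.closedBall c r))
    (hfin : ∀ c r, 0 < r → σ (Metric.closedBall c r) ≠ ∞)
    (hpos : ∀ c r, 0 < r → σ (Metric.closedBall c r) ≠ 0)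
    (S : Finset ι) (c : ι → Fin n → ℝ) (r : ι → ℝ)
    (hr : ∀ i ∈ S, 0 < r i) (g : (Fin n → ℝ) → ℝ≥0∞) (hg : Measurable g)
    (hgi : ∫⁻ y, g y ∂σ ≠ ∞) (m : ℕ)
    (E : ι → Set (Fin n → ℝ)) (hE : ∀ i ∈ S, MeasurableSet (E i))
    (hEB : ∀ i ∈ S, E i ⊆ Metric.closedBall (c i) (r i))
    (hov : ∀ x, ∑ i ∈ S, (E i).indicator (fun _ => (1:ℝ≥0∞)) x ≤ m) :
    ∑ i ∈ S, ((σ (Metric.closedBall (c i) (r i)))⁻¹ *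
        ∫⁻ y in Metric.closedBall (c i) (r i), g y ∂σ) ^ p * σ (E i) ≤
      m * (ENNReal.ofReal p * (2 * D) * 2 ^ (p - 1) * ENNReal.ofReal (1 / (p - 1))) *
        ∫⁻ x, g x ^ p ∂σ := by
  set A : ι → ℝ≥0∞ := fun i => (σ (Metric.closedBall (c i) (r i)))⁻¹ *
        ∫⁻ y in Metric.closedBall (c i) (r i), g y ∂σ with hA
  have hAtop : ∀ i ∈ S, A i ≠ ∞ := by
    intro i hi
    refine ENNReal.mul_ne_top (ENNReal.inv_ne_top.2 (hpos _ _ (hr i hi))) ?_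
    exact ((setLIntegral_le_lintegral _ _).trans_lt hgi.lt_top).ne
  set M : (Fin n → ℝ) → ℝ≥0∞ := fun x =>
    S.sup fun i => (Metric.closedBall (c i) (r i)).indicator (fun _ => A i) x with hMdef
  have hMm : Measurable M := by
    have : M = fun x => ⨆ i ∈ (S : Set ι), (Metric.closedBall (c i) (r i)).indicator (fun _ => A i) x := by
      ext x; simp [hMdef, Finset.sup_eq_iSup]
    rw [this]
    exact Measurable.biSup _ S.countable_toSet fun i _ =>
      measurable_const.indicator Metric.isClosed_closedBall.measurableSet
  have hMtop : ∀ x, M x ≠ ∞ := by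
    intro x
    refine ne_of_lt ?_
    rw [hMdef]
    simp only
    rw [Finset.sup_lt_iff (by simp)]
    intro i hi
    by_cases hx : x ∈ Metric.closedBall (c i) (r i)
    · simp [hx, (hAtop i hi).lt_top]
    · simp [hx]
  have hweak : ∀ t : ℝ, 0 < t → ENNReal.ofReal t * σ {x | ENNReal.ofReal t < M x} ≤
      (2 * D) * ∫⁻ y in {y | ENNReal.ofReal t < 2 * g y}, g y ∂σ := by
    intro t ht
    have hset : MeasurableSet {y | ENNReal.ofReal t < 2 * g y} :=
      measurableSet_lt measurable_const (by fun_prop)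
    obtain ⟨R, hR⟩ := (S.finite_toSet.image r).bddAbove
    have := vit_weak σ D hD {i | i ∈ S ∧ ENNReal.ofReal t < A i} c r R
      (fun i hi => hR ⟨i, hi.1, rfl⟩) (fun i hi => hr i hi.1)
      ({y | ENNReal.ofReal t < 2 * g y}.indicator g) (ENNReal.ofReal t / 2) ?_
    · rw [lintegral_indicator hset] at this
      have hsub : {x | ENNReal.ofReal t < M x} ⊆
          ⋃ i ∈ {i | i ∈ S ∧ ENNReal.ofReal t < A i}, Metric.closedBall (c i) (r i) := by
        intro x hx
        simp only [hMdef, mem_ofPred_eq, Finset.lt_sup_iff] at hx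
        obtain ⟨i, hi, hxi⟩ := hx
        by_cases hxB : x ∈ Metric.closedBall (c i) (r i)
        · rw [indicator_of_mem hxB] at hxi
          exact mem_biUnion (show i ∈ {i | i ∈ S ∧ ENNReal.ofReal t < A i} from ⟨hi, hxi⟩) hxB
        · rw [indicator_of_notMem hxB] at hxi
          simp at hxi
      calc _ ≤ ENNReal.ofReal t * σ (⋃ i ∈ {i | i ∈ S ∧ ENNReal.ofReal t < A i}, Metric.closedBall (c i) (r i)) := by gcongr
        _ = 2 * (ENNReal.ofReal t / 2 * σ (⋃ i ∈ {i | i ∈ S ∧ ENNReal.ofReal t < A i}, Metric.closedBall (c i) (r i))) := by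
            rw [← mul_assoc, ENNReal.mul_div_cancel (by norm_num) (by norm_num)]
        _ ≤ _ := by
            rw [mul_assoc]; gcongr
    · rintro i ⟨hi, hti⟩
      set B := Metric.closedBall (c i) (r i)
      have hB0 := hpos (c i) _ (hr i hi)
      have hBt := hfin (c i) _ (hr i hi)
      have h1 : ENNReal.ofReal t * σ B ≤ ∫⁻ y in B, g y ∂σ := by
        have : A i * σ B = ∫⁻ y in B, g y ∂σ := by
          simp only [hA]
          rw [mul_comm, ← mul_assoc, ENNReal.mul_inv_cancel hB0 hBt, one_mul]
        rw [← this]; gcongr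
      have h2 : ∫⁻ y in B, g y ∂σ ≤ ENNReal.ofReal t / 2 * σ B +
          ∫⁻ y in B, ({y | ENNReal.ofReal t < 2 * g y}.indicator g) y ∂σ := by
        rw [← setLIntegral_const, ← lintegral_add_left measurable_const]
        refine lintegral_mono fun y => ?_
        by_cases hy : ENNReal.ofReal t < 2 * g y
        · rw [indicator_of_mem (show y ∈ {y | ENNReal.ofReal t < 2 * g y} from hy)]
          exact le_add_self
        · refine le_trans ?_ le_self_add
          rw [ENNReal.le_div_iff_mul_le (by simp) (by simp), mul_comm]
          exact not_lt.1 hy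
      have h3 : ENNReal.ofReal t * σ B = ENNReal.ofReal t / 2 * σ B + ENNReal.ofReal t / 2 * σ B := by
        rw [← add_mul, ENNReal.add_halves]
      rw [h3] at h1
      refine (ENNReal.add_le_add_iff_left ?_).1 (h1.trans h2)
      exact ENNReal.mul_ne_top (ENNReal.div_ne_top ENNReal.ofReal_ne_top (by simp)) hBt
  have hstrong := strong_of_weak σ p hp (2 * D) M hMm hMtop g hg hweak
  calc ∑ i ∈ S, A i ^ p * σ (E i)
      = ∫⁻ x, ∑ i ∈ S, (E i).indicator (fun _ => A i ^ p) x ∂σ := by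
        rw [lintegral_finsetSum']
        · refine Finset.sum_congr rfl fun i hi => ?_
          rw [lintegral_indicator (hE i hi), setLIntegral_const]
        · exact fun i hi => (measurable_const.indicator (hE i hi)).aemeasurable
    _ ≤ ∫⁻ x, m * M x ^ p ∂σ := by
        refine lintegral_mono fun x => ?_
        calc ∑ i ∈ S, (E i).indicator (fun _ => A i ^ p) x
            ≤ ∑ i ∈ S, (E i).indicator (fun _ => (1:ℝ≥0∞)) x * M x ^ p := by
              refine Finset.sum_le_sum fun i hi => ?_
              by_cases hx : x ∈ E i
              · simp only [indicator_of_mem hx, one_mul]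
                refine ENNReal.rpow_le_rpow ?_ (by linarith)
                refine le_trans ?_ (Finset.le_sup (f := fun i => (Metric.closedBall (c i) (r i)).indicator (fun _ => A i) x) hi)
                simp only [indicator_of_mem (hEB i hi hx), le_refl]
              · simp [indicator_of_notMem hx]
          _ = (∑ i ∈ S, (E i).indicator (fun _ => (1:ℝ≥0∞)) x) * M x ^ p := by
              rw [Finset.sum_mul]
          _ ≤ _ := by gcongr; exact hov x
    _ = m * ∫⁻ x, M x ^ p ∂σ := by
        rw [lintegral_const_mul _ (by fun_prop)]
    _ ≤ _ := by rw [mul_assoc]; gcongr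

/-- fractional average over a sup-norm ball -/
def avA {n : ℕ} (β : ℝ) (F : (Fin n → ℝ) → ℝ≥0∞) (c : Fin n → ℝ) (r : ℝ) : ℝ≥0∞ :=
  volume (Metric.closedBall c r) ^ β *
    ((volume (Metric.closedBall c r))⁻¹ * ∫⁻ y in Metric.closedBall c r, F y)

/-- fractional maximal function for nonnegative functions -/
def Mx {n : ℕ} (β : ℝ) (F : (Fin n → ℝ) → ℝ≥0∞) (x : Fin n → ℝ) : ℝ≥0∞ :=
  ⨆ (c : Fin n → ℝ) (r : ℝ) (_ : 0 < r) (_ : x ∈ Metric.closedBall c r), avA β F c r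

lemma isCube_iff {n : ℕ} (Q : Set (Fin n → ℝ)) :
    IsCube n Q ↔ ∃ (c : Fin n → ℝ) (r : ℝ), 0 < r ∧ Q = Metric.closedBall c r := by
  constructor
  · rintro ⟨a, h, hh, rfl⟩
    refine ⟨fun i => a i + h / 2, h / 2, by positivity, ?_⟩
    rw [closedBall_pi _ (by positivity)]
    congr 1; ext i : 1
    rw [Real.closedBall_eq_Icc]
    congr 1 <;> ring
  · rintro ⟨c, r, hr, rfl⟩
    refine ⟨fun i => c i - r, 2 * r, by positivity, ?_⟩
    rw [closedBall_pi _ hr.le]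
    congr 1; ext i : 1
    rw [Real.closedBall_eq_Icc]
    congr 1; ring

lemma frac_eq {n : ℕ} (α : ℝ) (f : (Fin n → ℝ) → ℝ) (x : Fin n → ℝ) :
    fracMaximalFn n α f x = Mx (α / (n : ℝ)) (fun y => ENNReal.ofReal |f y|) x := by
  unfold fracMaximalFn Mx
  apply le_antisymm
  · refine iSup_le fun Q => iSup_le fun hQ => iSup_le fun hx => ?_
    obtain ⟨c, r, hr, rfl⟩ := (isCube_iff Q).1 hQ
    exact le_iSup_of_le c (le_iSup_of_le r (le_iSup_of_le hr (le_iSup_of_le hx le_rfl)))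
  · refine iSup_le fun c => iSup_le fun r => iSup_le fun hr => iSup_le fun hx => ?_
    exact le_iSup_of_le _ (le_iSup_of_le ((isCube_iff _).2 ⟨c, r, hr, rfl⟩) (le_iSup_of_le hx le_rfl))

lemma le_Mx {n : ℕ} (β : ℝ) (F : (Fin n → ℝ) → ℝ≥0∞) {x c : Fin n → ℝ} {r : ℝ} (hr : 0 < r)
    (hx : x ∈ Metric.closedBall c r) : avA β F c r ≤ Mx β F x :=
  le_iSup_of_le c (le_iSup_of_le r (le_iSup_of_le hr (le_iSup_of_le hx le_rfl)))

lemma lt_Mx {n : ℕ} {β : ℝ} {F : (Fin n → ℝ) → ℝ≥0∞} {x : Fin n → ℝ} {l : ℝ≥0∞}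
    (h : l < Mx β F x) : ∃ c r, 0 < r ∧ x ∈ Metric.closedBall c r ∧ l < avA β F c r := by
  unfold Mx at h
  simp only [lt_iSup_iff] at h
  obtain ⟨c, r, hr, hx, h⟩ := h
  exact ⟨c, r, hr, hx, h⟩

lemma vol_ne_zero {n : ℕ} (c : Fin n → ℝ) {r : ℝ} (hr : 0 < r) :
    volume (Metric.closedBall c r) ≠ 0 := (Metric.measure_closedBall_pos volume c hr).ne'

lemma vol_ne_top {n : ℕ} (c : Fin n → ℝ) (r : ℝ) :
    volume (Metric.closedBall c r) ≠ ∞ := measure_closedBall_lt_top.ne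

lemma vol_scale {n : ℕ} (c c' : Fin n → ℝ) {r : ℝ} (hr : 0 < r) {θ : ℝ} (hθ : 0 < θ) :
    volume (Metric.closedBall c (θ * r)) =
      ENNReal.ofReal θ ^ n * volume (Metric.closedBall c' r) := by
  rw [Real.volume_pi_closedBall _ (by positivity), Real.volume_pi_closedBall _ hr.le,
    Fintype.card_fin, show 2 * (θ * r) = θ * (2 * r) by ring, mul_pow,
    ENNReal.ofReal_mul (by positivity), ENNReal.ofReal_pow hθ.le]

lemma avA_scale {n : ℕ} {β : ℝ} (hβ : 0 ≤ β) (F : (Fin n → ℝ) → ℝ≥0∞) (c : Fin n → ℝ)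
    {r : ℝ} (hr : 0 < r) {θ : ℝ} (hθ : 1 ≤ θ) :
    (ENNReal.ofReal θ ^ n)⁻¹ * avA β F c r ≤ avA β F c (θ * r) := by
  have hsub : Metric.closedBall c r ⊆ Metric.closedBall c (θ * r) :=
    Metric.closedBall_subset_closedBall (by nlinarith)
  unfold avA
  have hθ0 : ENNReal.ofReal θ ^ n ≠ 0 := by
    have : 0 < θ := by linarith
    simp [this]
  have h1 : (volume (Metric.closedBall c (θ * r)))⁻¹ =
      (ENNReal.ofReal θ ^ n)⁻¹ * (volume (Metric.closedBall c r))⁻¹ := by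
    rw [vol_scale c c hr (by linarith), ENNReal.mul_inv (Or.inl hθ0) (Or.inr (vol_ne_zero c hr))]
  calc _ = volume (Metric.closedBall c r) ^ β * ((volume (Metric.closedBall c (θ * r)))⁻¹ * ∫⁻ y in Metric.closedBall c r, F y) := by
        rw [h1]; ring
    _ ≤ _ := by gcongr

lemma Mx_open {n : ℕ} {β : ℝ} (hβ : 0 ≤ β) (F : (Fin n → ℝ) → ℝ≥0∞) (l : ℝ≥0∞) :
    IsOpen {x | l < Mx β F x} := by
  rw [Metric.isOpen_iff]
  intro x hx
  obtain ⟨c, r, hr, hxB, hl⟩ := lt_Mx hx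
  have ht : Filter.Tendsto (fun θ : ℝ => (ENNReal.ofReal θ ^ n)⁻¹ * avA β F c r)
      (nhdsWithin 1 (Ioi 1)) (nhds (1 * avA β F c r)) := by
    refine ENNReal.Tendsto.mul_const ?_ (Or.inl (by simp))
    have : Filter.Tendsto (fun θ : ℝ => (ENNReal.ofReal θ ^ n)⁻¹) (nhds 1) (nhds ((ENNReal.ofReal 1 ^ n)⁻¹)) := by
      refine Filter.Tendsto.inv ?_
      exact ENNReal.Tendsto.pow (ENNReal.tendsto_ofReal Filter.tendsto_id)
    simp only [ENNReal.ofReal_one, one_pow, inv_one] at this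
    exact this.mono_left nhdsWithin_le_nhds
  rw [one_mul] at ht
  obtain ⟨θ, hθl, hθ⟩ := ((ht.eventually_const_lt hl).and self_mem_nhdsWithin).exists
  have hθ' : 1 < θ := hθ
  refine ⟨θ * r - r, by nlinarith, fun y hy => ?_⟩
  have hyB : y ∈ Metric.closedBall c (θ * r) := by
    rw [Metric.mem_closedBall] at hxB ⊢
    rw [Metric.mem_ball] at hy
    linarith [dist_triangle y x c]
  exact (hθl.trans_le (avA_scale hβ F c hr hθ'.le)).trans_le (le_Mx β F (by nlinarith) hyB)

lemma sparse_bound {n : ℕ} {β : ℝ} (hβ : 0 ≤ β) (F : (Fin n → ℝ) → ℝ≥0∞)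
    (c : Fin n → ℝ) {r : ℝ} (hr : 0 < r) (x0 : Fin n → ℝ) (hx0 : x0 ∈ Metric.closedBall c r)
    (l : ℝ≥0∞) (hl0 : l ≠ 0) (hltop : l ≠ ∞) (hMl : Mx β F x0 ≤ l) (N : ℝ≥0∞) (hN : 3 ^ n ≤ N) :
    N * volume (Metric.closedBall c r ∩ {x | N * l < Mx β F x}) ≤
      15 ^ n * volume (Metric.closedBall c r) := by
  set V := volume (Metric.closedBall c r) with hV
  have hV0 : V ≠ 0 := vol_ne_zero c hr
  have hVt : V ≠ ∞ := vol_ne_top c r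
  have hy0 : V ^ β ≠ 0 := by simp [ENNReal.rpow_eq_zero_iff, hV0, hVt]
  have hyt : V ^ β ≠ ∞ := by simp [ENNReal.rpow_eq_top_iff, hV0, hVt]
  set T : Set ((Fin n → ℝ) × ℝ) := {P | 0 < P.2 ∧ P.2 ≤ r ∧
    Metric.closedBall P.1 P.2 ⊆ Metric.closedBall c (3 * r) ∧ N * l < avA β F P.1 P.2} with hT
  have h3 : ∀ c : Fin n → ℝ, ∀ r : ℝ, 0 < r → avA β F c r ≤ 3 ^ n * avA β F c (3 * r) := by
    intro c r hr
    have := avA_scale hβ F c hr (θ := 3) (by norm_num)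
    rw [ENNReal.inv_mul_le_iff (by simp) (by simp)] at this
    simpa using this
  have hcov : Metric.closedBall c r ∩ {x | N * l < Mx β F x} ⊆
      ⋃ P ∈ T, Metric.closedBall P.1 P.2 := by
    rintro y ⟨hyB, hy⟩
    obtain ⟨c', r', hr', hy', hl'⟩ := lt_Mx hy
    rw [Metric.mem_closedBall] at hyB hy' hx0
    rcases le_or_gt r r' with hrr | hrr
    · exfalso
      have hx3 : x0 ∈ Metric.closedBall c' (3 * r') := by
        rw [Metric.mem_closedBall]
        have := dist_triangle x0 c c'
        have := dist_triangle_left c c' y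
        linarith
      have : avA β F c' r' ≤ N * l := by
        calc _ ≤ 3 ^ n * avA β F c' (3 * r') := h3 _ _ hr'
          _ ≤ N * l := by
            gcongr
            exact (le_Mx β F (by positivity) hx3).trans hMl
      exact absurd hl' (not_lt.2 this)
    · refine mem_biUnion (show (c', r') ∈ T from ⟨hr', hrr.le, ?_, hl'⟩) hy'
      intro z hz
      rw [Metric.mem_closedBall] at hz ⊢
      have := dist_triangle z c' c
      have := dist_triangle_left c' c y
      simp only at hz
      linarith
  have hvit := vit_weak (volume : Measure (Fin n → ℝ)) (5 ^ n)
    (fun c r hr => by rw [vol_scale c c hr (by norm_num)]; simp) T (fun P => P.1) (fun P => P.2) r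
    (fun P hP => hP.2.1) (fun P hP => hP.1) ((Metric.closedBall c (3 * r)).indicator F)
    (N * l * (V ^ β)⁻¹) ?_
  · rw [lintegral_indicator Metric.isClosed_closedBall.measurableSet] at hvit
    have h4 : V ^ β * ∫⁻ y in Metric.closedBall c (3 * r), F y ≤ l * (3 ^ n * V) := by
      have hx3 : x0 ∈ Metric.closedBall c (3 * r) :=
        Metric.closedBall_subset_closedBall (by linarith) hx0
      have h5 : avA β F c (3 * r) ≤ l := (le_Mx β F (by positivity) hx3).trans hMl
      have h6 : volume (Metric.closedBall c (3 * r)) = 3 ^ n * V := by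
        rw [vol_scale c c hr (by norm_num)]; simp [hV]
      have hmono : V ^ β ≤ volume (Metric.closedBall c (3 * r)) ^ β := by
        apply ENNReal.rpow_le_rpow _ hβ
        exact measure_mono (Metric.closedBall_subset_closedBall (by linarith))
      have h7 : V ^ β * (∫⁻ y in Metric.closedBall c (3 * r), F y) =
          (3 ^ n * V) * (V ^ β * ((3 ^ n * V)⁻¹ * ∫⁻ y in Metric.closedBall c (3 * r), F y)) := by
        have : (3 ^ n * V) * (3 ^ n * V)⁻¹ = 1 := ENNReal.mul_inv_cancel (by simp [hV0]) (ENNReal.mul_ne_top (by simp) hVt)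
        calc _ = ((3 ^ n * V) * (3 ^ n * V)⁻¹) * (V ^ β * ∫⁻ y in Metric.closedBall c (3 * r), F y) := by rw [this, one_mul]
          _ = _ := by ring
      rw [h7, mul_comm l]
      gcongr
      refine le_trans ?_ h5
      unfold avA
      rw [← h6]
      gcongr
    have h8 : l * (N * volume (Metric.closedBall c r ∩ {x | N * l < Mx β F x})) ≤
        l * (15 ^ n * V) := by
      calc _ ≤ l * (N * volume (⋃ P ∈ T, Metric.closedBall P.1 P.2)) := by gcongr
        _ = V ^ β * (N * l * (V ^ β)⁻¹ * volume (⋃ P ∈ T, Metric.closedBall P.1 P.2)) := by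
            have : V ^ β * (V ^ β)⁻¹ = 1 := ENNReal.mul_inv_cancel hy0 hyt
            calc _ = (V ^ β * (V ^ β)⁻¹) * (l * (N * volume (⋃ P ∈ T, Metric.closedBall P.1 P.2))) := by rw [this, one_mul]
              _ = _ := by ring
        _ ≤ V ^ β * (5 ^ n * ∫⁻ y in Metric.closedBall c (3 * r), F y) := by gcongr
        _ = 5 ^ n * (V ^ β * ∫⁻ y in Metric.closedBall c (3 * r), F y) := by ring
        _ ≤ 5 ^ n * (l * (3 ^ n * V)) := by gcongr
        _ = l * (15 ^ n * V) := by
            rw [show (15:ℝ≥0∞) = 5 * 3 by norm_num, mul_pow]; ring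
    exact (ENNReal.mul_le_mul_iff_right hl0 hltop).1 h8
  · rintro ⟨c', r'⟩ ⟨hr', hrr, hsub, hav⟩
    simp only at hr' hrr hsub hav ⊢
    set P := Metric.closedBall c' r'
    have hP0 : volume P ≠ 0 := vol_ne_zero c' hr'
    have hPt : volume P ≠ ∞ := vol_ne_top c' r'
    have hPV : volume P ≤ V := by
      rw [hV, show volume P = volume (Metric.closedBall c r') by
        simp only [P]; rw [Real.volume_pi_closedBall _ hr'.le, Real.volume_pi_closedBall _ hr'.le]]
      exact measure_mono (Metric.closedBall_subset_closedBall hrr)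
    have hI : ∫⁻ y in P, (Metric.closedBall c (3 * r)).indicator F y = ∫⁻ y in P, F y :=
      setLIntegral_congr_fun Metric.isClosed_closedBall.measurableSet
        fun y hy => indicator_of_mem (hsub hy) F
    rw [hI]
    calc N * l * (V ^ β)⁻¹ * volume P ≤ avA β F c' r' * (V ^ β)⁻¹ * volume P := by gcongr
      _ ≤ (V ^ β * ((volume P)⁻¹ * ∫⁻ y in P, F y)) * (V ^ β)⁻¹ * volume P := by
          unfold avA
          gcongr
      _ = (V ^ β * (V ^ β)⁻¹) * (volume P * (volume P)⁻¹) * ∫⁻ y in P, F y := by ring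
      _ = ∫⁻ y in P, F y := by
          rw [ENNReal.mul_inv_cancel hy0 hyt, ENNReal.mul_inv_cancel hP0 hPt, one_mul, one_mul]

lemma radius_bound {n : ℕ} (hn : 1 ≤ n) {β : ℝ} (hβ1 : β < 1) (F : (Fin n → ℝ) → ℝ≥0∞)
    (hF : ∫⁻ y, F y ≠ ∞) (l : ℝ≥0∞) (hl : l ≠ 0) :
    ∃ R : ℝ, 0 < R ∧ ∀ c r, 0 < r → l < avA β F c r → r ≤ R := by
  set I := ∫⁻ y, F y
  set K := (I / l) ^ (1 / (1 - β)) with hK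
  have hb : 0 < 1 - β := by linarith
  have hKt : K ≠ ∞ := ENNReal.rpow_ne_top_of_nonneg (by positivity) (ENNReal.div_ne_top hF hl)
  refine ⟨max 1 K.toReal, by positivity, fun c r hr h => ?_⟩
  by_contra! hcon
  have hr1 : 1 < r := (le_max_left _ _).trans_lt hcon
  have hrK : K.toReal < r := (le_max_right _ _).trans_lt hcon
  set V := volume (Metric.closedBall c r) with hV
  have hV0 : V ≠ 0 := vol_ne_zero c hr
  have hVt : V ≠ ∞ := vol_ne_top c r
  have hKV : K < V := by
    rw [hV, Real.volume_pi_closedBall _ hr.le, Fintype.card_fin, ← ENNReal.ofReal_toReal hKt,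
      ENNReal.ofReal_lt_ofReal_iff (by positivity)]
    have : (2 * r) ^ 1 ≤ (2 * r) ^ n := pow_le_pow_right₀ (by linarith) hn
    linarith
  have h1 : l ≤ V ^ (β - 1) * I := by
    refine h.le.trans ?_
    unfold avA
    rw [← mul_assoc, ← ENNReal.rpow_neg_one, ← ENNReal.rpow_add _ _ hV0 hVt, ← sub_eq_add_neg]
    gcongr
    exact setLIntegral_le_lintegral _ _
  have h2 : l * V ^ (1 - β) ≤ I := by
    calc _ ≤ V ^ (β - 1) * I * V ^ (1 - β) := by gcongr
      _ = (V ^ (β - 1) * V ^ (1 - β)) * I := by ring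
      _ = I := by rw [← ENNReal.rpow_add _ _ hV0 hVt]; simp
  have h3 : V ^ (1 - β) ≤ I / l := by
    rw [ENNReal.le_div_iff_mul_le (Or.inl hl) (Or.inr hF), mul_comm]; exact h2
  have h4 : V ≤ K := by
    calc V = (V ^ (1 - β)) ^ (1 / (1 - β)) := by
          rw [← ENNReal.rpow_mul, mul_one_div_cancel hb.ne', ENNReal.rpow_one]
      _ ≤ K := by rw [hK]; gcongr
  exact absurd hKV (not_lt.2 h4)

lemma Mx_finite {n : ℕ} (hn : 1 ≤ n) {β : ℝ} (hβ : 0 ≤ β) (hβ1 : β < 1) (F : (Fin n → ℝ) → ℝ≥0∞)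
    (hF : ∫⁻ y, F y ≠ ∞) (N : ℝ≥0∞) (hN : N ≠ ∞) (hFN : ∀ y, F y ≤ N) (x : Fin n → ℝ) :
    Mx β F x ≠ ∞ := by
  obtain ⟨R, hR, hbd⟩ := radius_bound hn hβ1 F hF 1 one_ne_zero
  have : Mx β F x ≤ max 1 (volume (Metric.closedBall (0 : Fin n → ℝ) R) ^ β * N) := by
    refine iSup_le fun c => iSup_le fun r => iSup_le fun hr => iSup_le fun hx => ?_
    rcases le_or_gt (avA β F c r) 1 with h | h
    · exact h.trans (le_max_left _ _)
    · refine le_trans ?_ (le_max_right _ _)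
      have hrR := hbd c r hr h
      have hv : volume (Metric.closedBall c r) ≤ volume (Metric.closedBall (0 : Fin n → ℝ) R) := by
        rw [Real.volume_pi_closedBall _ hr.le, Real.volume_pi_closedBall _ hR.le]
        gcongr
      have hi : (volume (Metric.closedBall c r))⁻¹ * ∫⁻ y in Metric.closedBall c r, F y ≤ N := by
        rw [ENNReal.inv_mul_le_iff (vol_ne_zero c hr) (vol_ne_top c r), mul_comm, ← setLIntegral_const]
        exact lintegral_mono fun y => hFN y
      unfold avA
      gcongr
  refine (this.trans_lt ?_).ne
  refine max_lt ENNReal.one_lt_top (ENNReal.mul_ne_top ?_ hN).lt_top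
  exact ENNReal.rpow_ne_top_of_nonneg hβ (vol_ne_top _ _)

lemma ofReal_two_zpow (k : ℤ) : ENNReal.ofReal ((2:ℝ) ^ k) = 2 ^ k := by
  rw [← Real.rpow_intCast, ← ENNReal.ofReal_rpow_of_pos (by norm_num), ENNReal.rpow_intCast]
  simp

lemma tsum_rpow_le {ι : Type*} (a : ι → ℝ≥0∞) (s : ℝ) (hs : 1 ≤ s) :
    ∑' i, a i ^ s ≤ (∑' i, a i) ^ s := by
  have key : ∀ b : ℝ≥0∞, b ^ s = b * b ^ (s - 1) := by
    intro b
    conv_lhs => rw [show s = 1 + (s - 1) by ring]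
    rw [ENNReal.rpow_add_of_nonneg _ _ (by norm_num) (by linarith), ENNReal.rpow_one]
  calc ∑' i, a i ^ s = ∑' i, a i * a i ^ (s - 1) := by simp_rw [key]
    _ ≤ ∑' i, a i * (∑' j, a j) ^ (s - 1) := by
        gcongr with i
        exact ENNReal.le_tsum i
    _ = _ := by rw [ENNReal.tsum_mul_right, ← key]

lemma term_bound (n : ℕ) (β p q κ : ℝ) (hp : 1 < p) (hq : 0 < q) (hκ : κ = q * (1 - 1 / p))
    (hβ : q * (β - 1) + 1 + κ = 0) (K V S I t T v : ℝ≥0∞)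
    (hV0 : V ≠ 0) (hVt : V ≠ ∞) (hS0 : S ≠ 0) (hSt : S ≠ ∞) (hT0 : T ≠ 0) (hTt : T ≠ ∞)
    (h1 : (t * (2 * T)⁻¹) ^ q * v * S ^ κ ≤ K * (5 ^ n * V) ^ (1 + κ))
    (h2 : T ≤ V ^ β * (V⁻¹ * I)) :
    t ^ q * v ≤ (2 ^ q * K * (5 ^ n) ^ (1 + κ)) * ((S⁻¹ * I) ^ p * S) ^ (q / p) := by
  have hp0 : 0 < p := by linarith
  have hκ0 : 0 ≤ κ := by
    rw [hκ]
    have : 1 / p ≤ 1 := by rw [div_le_one hp0]; exact hp.le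
    have : 0 ≤ 1 - 1 / p := by linarith
    positivity
  have h2T0 : 2 * T ≠ 0 := mul_ne_zero (by norm_num) hT0
  have h2Tt : 2 * T ≠ ∞ := ENNReal.mul_ne_top (by norm_num) hTt
  have e1 : t ^ q * v = (2 * T) ^ q * ((t * (2 * T)⁻¹) ^ q * v * S ^ κ) * S ^ (-κ) := by
    have a1 : S ^ κ * S ^ (-κ) = 1 := by rw [← ENNReal.rpow_add _ _ hS0 hSt]; simp
    have a2 : (2 * T) ^ q * (t * (2 * T)⁻¹) ^ q = t ^ q := by
      rw [← ENNReal.mul_rpow_of_nonneg _ _ hq.le]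
      congr 1
      calc _ = ((2 * T) * (2 * T)⁻¹) * t := by ring
        _ = t := by rw [ENNReal.mul_inv_cancel h2T0 h2Tt, one_mul]
    calc _ = ((2 * T) ^ q * (t * (2 * T)⁻¹) ^ q) * v * (S ^ κ * S ^ (-κ)) := by rw [a1, a2, mul_one]
      _ = _ := by ring
  have e2 : ((S⁻¹ * I) ^ p * S) ^ (q / p) = I ^ q * S ^ (-κ) := by
    rw [ENNReal.mul_rpow_of_nonneg _ _ (by positivity), ← ENNReal.rpow_mul,
      mul_div_cancel₀ _ hp0.ne', ENNReal.mul_rpow_of_nonneg _ _ hq.le, ← ENNReal.rpow_neg_one,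
      ← ENNReal.rpow_mul]
    calc _ = I ^ q * (S ^ (-1 * q) * S ^ (q / p)) := by ring
      _ = _ := by
        rw [← ENNReal.rpow_add _ _ hS0 hSt]
        congr 2
        rw [hκ]; ring
  have e3 : T ^ q * V ^ (1 + κ) ≤ I ^ q := by
    calc _ ≤ (V ^ β * (V⁻¹ * I)) ^ q * V ^ (1 + κ) := by gcongr
      _ = (V ^ (β - 1) * I) ^ q * V ^ (1 + κ) := by
        rw [← mul_assoc, ← ENNReal.rpow_neg_one, ← ENNReal.rpow_add _ _ hV0 hVt, ← sub_eq_add_neg]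
      _ = (V ^ ((β - 1) * q) * V ^ (1 + κ)) * I ^ q := by
        rw [ENNReal.mul_rpow_of_nonneg _ _ hq.le, ← ENNReal.rpow_mul]; ring
      _ = I ^ q := by
        rw [← ENNReal.rpow_add _ _ hV0 hVt, show (β - 1) * q + (1 + κ) = 0 by linarith]; simp
  calc t ^ q * v ≤ (2 * T) ^ q * (K * (5 ^ n * V) ^ (1 + κ)) * S ^ (-κ) := by
        rw [e1]; gcongr
    _ = (2 ^ q * K * (5 ^ n) ^ (1 + κ)) * (T ^ q * V ^ (1 + κ) * S ^ (-κ)) := by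
        rw [ENNReal.mul_rpow_of_nonneg _ _ hq.le, ENNReal.mul_rpow_of_nonneg _ _ (by linarith)]
        ring
    _ ≤ _ := by
        rw [e2]; gcongr

lemma main_nice (n : ℕ) (hn : 1 ≤ n) (β p q κ : ℝ) (hp : 1 < p) (hpq : p ≤ q)
    (hκ : κ = q * (1 - 1 / p)) (hβ0 : 0 ≤ β) (hβ1 : β < 1)
    (hβ : q * (β - 1) + 1 + κ = 0) (w : (Fin n → ℝ) → ℝ)
    (σ : Measure (Fin n → ℝ)) [SFinite σ] (D K C2 : ℝ≥0∞)
    (hD : ∀ c r, 0 < r → σ (Metric.closedBall c (5 * r)) ≤ D * σ (Metric.closedBall c r))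
    (hfin : ∀ c r, 0 < r → σ (Metric.closedBall c r) ≠ ∞)
    (hpos : ∀ c r, 0 < r → σ (Metric.closedBall c r) ≠ 0)
    (hA : ∀ c r, 0 < r → ∀ t : ℝ, 0 < t →
      ENNReal.ofReal t ^ q * volume (Metric.closedBall c r ∩ {x | t < w x}) *
        σ (Metric.closedBall c r) ^ κ ≤ K * volume (Metric.closedBall c r) ^ (1 + κ))
    (hC2 : ∀ c r, 0 < r → ∀ E, MeasurableSet E → E ⊆ Metric.closedBall c r →
      volume (Metric.closedBall c r) ≤ 2 * volume E → σ (Metric.closedBall c r) ≤ C2 * σ E)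
    (m : ℕ) (hm : 2 * 15 ^ n ≤ 2 ^ m)
    (F g : (Fin n → ℝ) → ℝ≥0∞) (hg : Measurable g)
    (hFI : ∫⁻ y, F y ≠ ∞) (N : ℝ≥0∞) (hN : N ≠ ∞) (hFN : ∀ y, F y ≤ N)
    (hgF : ∀ c r, ∫⁻ y in Metric.closedBall c r, g y ∂σ = ∫⁻ y in Metric.closedBall c r, F y)
    (hgI : ∫⁻ y, g y ∂σ ≠ ∞) (t : ℝ) (ht : 0 < t) :
    ENNReal.ofReal t ^ q * volume {x | ENNReal.ofReal t < ENNReal.ofReal (w x) * Mx β F x} ≤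
      (2 ^ q * K * (5 ^ n) ^ (1 + κ)) *
      (C2 * (((m + 1 : ℕ) : ℝ≥0∞) * (ENNReal.ofReal p * (2 * D) * 2 ^ (p - 1) * ENNReal.ofReal (1 / (p - 1))) *
        ∫⁻ x, g x ^ p ∂σ)) ^ (q / p) := by
  have hp0 : 0 < p := by linarith
  have hq0 : 0 < q := by linarith
  have hz0 : ∀ k : ℤ, (2:ℝ≥0∞) ^ k ≠ 0 := fun k => (ENNReal.zpow_pos (by norm_num) (by norm_num) k).ne'
  have hzt : ∀ k : ℤ, (2:ℝ≥0∞) ^ k ≠ ∞ := fun k => (ENNReal.zpow_lt_top (by norm_num) (by norm_num) k).ne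
  have hzmono : ∀ j k : ℤ, (2:ℝ≥0∞) ^ j < 2 ^ k → j < k := by
    intro j k h
    by_contra! hc
    exact absurd h (not_lt.2 (ENNReal.zpow_le_of_le (by norm_num) hc))
  have hzsucc : ∀ k : ℤ, (2:ℝ≥0∞) ^ (k + 1) = 2 * 2 ^ k := by
    intro k
    rw [ENNReal.zpow_add (by norm_num) (by norm_num), zpow_one, mul_comm]
  set T : ℤ → Set ((Fin n → ℝ) × ℝ) := fun k => {P | 0 < P.2 ∧ 2 ^ k < avA β F P.1 P.2 ∧
    ∃ x ∈ Metric.closedBall P.1 P.2, Mx β F x ≤ 2 ^ (k + 1)} with hT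
  have hvit : ∀ k : ℤ, ∃ u ⊆ T k, (u.PairwiseDisjoint fun a => Metric.closedBall a.1 a.2) ∧
      ∀ a ∈ T k, ∃ b ∈ u, Metric.closedBall a.1 a.2 ⊆ Metric.closedBall b.1 (5 * b.2) := by
    intro k
    obtain ⟨R, -, hR⟩ := radius_bound hn hβ1 F hFI (2 ^ k) (hz0 k)
    exact Vitali.exists_disjoint_subfamily_covering_enlargement_closedBall (T k)
      (fun P => P.1) (fun P => P.2) R (fun P hP => hR _ _ hP.1 hP.2.1) 5 (by norm_num)
  choose u huT hdisj hcov using hvit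
  have hcount : ∀ k, (u k).Countable := fun k => by
    refine (hdisj k).countable_of_nonempty_interior fun i hi => ?_
    refine ⟨i.1, ?_⟩
    exact Metric.ball_subset_interior_closedBall (Metric.mem_ball_self (huT k hi).1)
  have : ∀ k, Countable (u k) := fun k => (hcount k).to_subtype
  let c : (Σ k : ℤ, u k) → Fin n → ℝ := fun i => i.2.1.1
  let r : (Σ k : ℤ, u k) → ℝ := fun i => i.2.1.2
  let E : (Σ k : ℤ, u k) → Set (Fin n → ℝ) := fun i =>
    Metric.closedBall (c i) (r i) \ {x | 2 ^ m * 2 ^ (i.1 + 1) < Mx β F x}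
  have hr : ∀ i, 0 < r i := fun i => (huT i.1 i.2.2).1
  have hav : ∀ i, 2 ^ i.1 < avA β F (c i) (r i) := fun i => (huT i.1 i.2.2).2.1
  have hEm : ∀ i, MeasurableSet (E i) := fun i =>
    Metric.isClosed_closedBall.measurableSet.diff (Mx_open hβ0 F _).measurableSet
  have hEB : ∀ i, E i ⊆ Metric.closedBall (c i) (r i) := fun i => sdiff_subset
  have hE2 : ∀ i, σ (Metric.closedBall (c i) (r i)) ≤ C2 * σ (E i) := by
    intro i
    refine hC2 _ _ (hr i) _ (hEm i) (hEB i) ?_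
    obtain ⟨x0, hx0, hMx0⟩ := (huT i.1 i.2.2).2.2
    have hsp := sparse_bound hβ0 F (c i) (hr i) x0 hx0 (2 ^ (i.1 + 1)) (hz0 _) (hzt _) hMx0 (2 ^ m) ?_
    · set V := volume (Metric.closedBall (c i) (r i)) with hV
      set v := volume (Metric.closedBall (c i) (r i) ∩ {x | 2 ^ m * 2 ^ (i.1 + 1) < Mx β F x}) with hv
      have hVt : V ≠ ∞ := vol_ne_top _ _
      have h15 : (15:ℝ≥0∞) ^ n ≠ 0 := by simp
      have h15t : (15:ℝ≥0∞) ^ n ≠ ∞ := by simp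
      have h2v : 2 * v ≤ V := by
        refine (ENNReal.mul_le_mul_iff_right h15 h15t).1 (le_trans ?_ hsp)
        calc (15:ℝ≥0∞) ^ n * (2 * v) = (2 * 15 ^ n) * v := by ring
          _ ≤ 2 ^ m * v := by gcongr; exact_mod_cast hm
      have hVE : V ≤ v + volume (E i) := by
        rw [hV, hv]
        exact measure_le_inter_add_sdiff _ _ _
      have : V + V ≤ V + 2 * volume (E i) := by
        calc V + V ≤ (v + volume (E i)) + (v + volume (E i)) := by gcongr
          _ = 2 * v + 2 * volume (E i) := by ring
          _ ≤ _ := by gcongr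
      exact (ENNReal.add_le_add_iff_left hVt).1 this
    · have : 3 ^ n ≤ 2 ^ m := by
        have : 3 ^ n ≤ 15 ^ n := Nat.pow_le_pow_left (by norm_num) n
        omega
      exact_mod_cast this
  have hov : ∀ (S : Finset (Σ k : ℤ, u k)) (x : Fin n → ℝ),
      ∑ i ∈ S, (E i).indicator (fun _ => (1:ℝ≥0∞)) x ≤ ((m + 1 : ℕ) : ℝ≥0∞) := by
    intro S x
    classical
    have hsum : ∑ i ∈ S, (E i).indicator (fun _ => (1:ℝ≥0∞)) x =
        ((S.filter fun i => x ∈ E i).card : ℝ≥0∞) := by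
      rw [Finset.card_filter]
      push_cast
      refine Finset.sum_congr rfl fun i _ => ?_
      simp [indicator_apply]
    rw [hsum]
    norm_cast
    rcases (S.filter fun i => x ∈ E i).eq_empty_or_nonempty with h0 | ⟨i0, hi0⟩
    · rw [h0]; simp
    have hMt := Mx_finite hn hβ0 hβ1 F hFI N hN hFN x
    have hM0 : Mx β F x ≠ 0 := by
      have hx := hEB i0 (Finset.mem_filter.1 hi0).2
      exact ((zero_le).trans_lt ((hav i0).trans_le (le_Mx β F (hr i0) hx))).ne'
    obtain ⟨k0, hk0, hk1⟩ := ENNReal.exists_mem_Ioc_zpow hM0 hMt (y := 2) (by norm_num) (by norm_num)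
    have hcard : (Finset.Icc (k0 - m) k0).card = m + 1 := by
      rw [Int.card_Icc]; omega
    rw [← hcard]
    refine Finset.card_le_card_of_injOn (fun i => i.1) ?_ ?_
    · intro i hi
      have hxE := (Finset.mem_filter.1 hi).2
      have h1 : (2:ℝ≥0∞) ^ i.1 < 2 ^ (k0 + 1) :=
        ((hav i).trans_le (le_Mx β F (hr i) (hEB i hxE))).trans_le hk1
      have h2 : Mx β F x ≤ 2 ^ m * 2 ^ (i.1 + 1) := not_lt.1 hxE.2
      have h3 : (2:ℝ≥0∞) ^ k0 < 2 ^ ((m:ℤ) + (i.1 + 1)) := by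
        rw [ENNReal.zpow_add (by norm_num) (by norm_num), zpow_natCast]
        exact hk0.trans_le h2
      have := hzmono _ _ h1
      have := hzmono _ _ h3
      simp only [Finset.coe_Icc, mem_Icc]
      omega
    · rintro ⟨k, P, hP⟩ hi ⟨k', P', hP'⟩ hi' (rfl : k = k')
      have hx1 := hEB _ (Finset.mem_filter.1 hi).2
      have hx2 := hEB _ (Finset.mem_filter.1 hi').2
      have : P = P' := by
        by_contra hne
        exact (Set.disjoint_left.1 (hdisj k hP hP' hne)) hx1 hx2
      subst this
      rfl
  set A : (Σ k : ℤ, u k) → ℝ≥0∞ := fun i => (σ (Metric.closedBall (c i) (r i)))⁻¹ *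
    ∫⁻ y in Metric.closedBall (c i) (r i), g y ∂σ with hAdef
  have hcarl : ∑' i, A i ^ p * σ (Metric.closedBall (c i) (r i)) ≤
      C2 * (((m + 1 : ℕ) : ℝ≥0∞) * (ENNReal.ofReal p * (2 * D) * 2 ^ (p - 1) * ENNReal.ofReal (1 / (p - 1))) *
        ∫⁻ x, g x ^ p ∂σ) := by
    calc _ ≤ ∑' i, C2 * (A i ^ p * σ (E i)) := by
          refine ENNReal.tsum_le_tsum fun i => ?_
          calc _ ≤ A i ^ p * (C2 * σ (E i)) := by gcongr; exact hE2 i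
            _ = _ := by ring
      _ = C2 * ∑' i, A i ^ p * σ (E i) := ENNReal.tsum_mul_left
      _ ≤ _ := by
          gcongr
          rw [ENNReal.tsum_eq_iSup_sum]
          exact iSup_le fun S => fin_embed σ p hp D hD hfin hpos S c r (fun i _ => hr i) g hg hgI (m + 1) E
            (fun i _ => hEm i) (fun i _ => hEB i) (hov S)
  have hcover : {x | ENNReal.ofReal t < ENNReal.ofReal (w x) * Mx β F x} ⊆
      ⋃ i : (Σ k : ℤ, u k), Metric.closedBall (c i) (5 * r i) ∩ {x | t * (2 * 2 ^ i.1)⁻¹ < w x} := by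
    intro x hx
    have hx' : ENNReal.ofReal t < ENNReal.ofReal (w x) * Mx β F x := hx
    have hMt := Mx_finite hn hβ0 hβ1 F hFI N hN hFN x
    have hM0 : Mx β F x ≠ 0 := by
      intro h0
      rw [h0, mul_zero] at hx'
      exact absurd hx' (by simp)
    obtain ⟨k, hk0, hk1⟩ := ENNReal.exists_mem_Ioc_zpow hM0 hMt (y := 2) (by norm_num) (by norm_num)
    obtain ⟨c', r', hr', hxB, hl⟩ := lt_Mx hk0
    obtain ⟨b, hb, hsub⟩ := hcov k (c', r') ⟨hr', hl, x, hxB, hk1⟩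
    refine mem_iUnion.2 ⟨⟨k, b, hb⟩, hsub hxB, ?_⟩
    have h1 : ENNReal.ofReal t < ENNReal.ofReal (w x) * ENNReal.ofReal (2 * 2 ^ k) := by
      refine hx'.trans_le ?_
      gcongr
      refine hk1.trans (le_of_eq ?_)
      rw [hzsucc, ENNReal.ofReal_mul (by norm_num), ofReal_two_zpow]
      simp
    rw [← ENNReal.ofReal_mul' (by positivity)] at h1
    have h2 := (ENNReal.ofReal_lt_ofReal_iff').1 h1
    show t * (2 * 2 ^ k)⁻¹ < w x
    rw [← div_eq_mul_inv, div_lt_iff₀ (by positivity)]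
    exact h2.1
  calc _ ≤ ENNReal.ofReal t ^ q * ∑' i : (Σ k : ℤ, u k),
        volume (Metric.closedBall (c i) (5 * r i) ∩ {x | t * (2 * 2 ^ i.1)⁻¹ < w x}) := by
        gcongr
        exact (measure_mono hcover).trans (measure_iUnion_le _)
    _ = ∑' i : (Σ k : ℤ, u k), ENNReal.ofReal t ^ q *
        volume (Metric.closedBall (c i) (5 * r i) ∩ {x | t * (2 * 2 ^ i.1)⁻¹ < w x}) :=
        ENNReal.tsum_mul_left.symm
    _ ≤ ∑' i : (Σ k : ℤ, u k), (2 ^ q * K * (5 ^ n) ^ (1 + κ)) *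
        (A i ^ p * σ (Metric.closedBall (c i) (r i))) ^ (q / p) := by
        refine ENNReal.tsum_le_tsum fun i => ?_
        refine term_bound n β p q κ hp hq0 hκ hβ K (volume (Metric.closedBall (c i) (r i))) _ _ _
          (2 ^ i.1) _ (vol_ne_zero _ (hr i)) (vol_ne_top _ _) (hpos _ _ (hr i)) (hfin _ _ (hr i))
          (hz0 _) (hzt _) ?_ ?_
        · have h5 := hA (c i) (5 * r i) (by have := hr i; positivity) (t * (2 * 2 ^ i.1)⁻¹) (by positivity)
          rw [vol_scale (c i) (c i) (hr i) (θ := 5) (by norm_num)] at h5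
          simp only [ENNReal.ofReal_ofNat] at h5
          refine le_trans ?_ h5
          have hκ0 : 0 ≤ κ := by
            rw [hκ]
            have : 1 / p ≤ 1 := by rw [div_le_one hp0]; exact hp.le
            have : 0 ≤ 1 - 1 / p := by linarith
            positivity
          have e : ENNReal.ofReal (t * (2 * 2 ^ i.1)⁻¹) = ENNReal.ofReal t * (2 * 2 ^ i.1)⁻¹ := by
            rw [ENNReal.ofReal_mul ht.le, ENNReal.ofReal_inv_of_pos (by positivity),
              ENNReal.ofReal_mul (by norm_num), ofReal_two_zpow]
            simp
          rw [e]
          have := hr i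
          gcongr
          linarith
        · rw [hgF]
          exact (hav i).le
    _ = (2 ^ q * K * (5 ^ n) ^ (1 + κ)) * ∑' i : (Σ k : ℤ, u k),
        (A i ^ p * σ (Metric.closedBall (c i) (r i))) ^ (q / p) := ENNReal.tsum_mul_left
    _ ≤ _ := by
        gcongr
        refine (tsum_rpow_le _ _ ?_).trans ?_
        · rw [le_div_iff₀ hp0]; linarith
        · gcongr

/-- the dual weight -/
def sW {n : ℕ} (p : ℝ) (w : (Fin n → ℝ) → ℝ) (x : Fin n → ℝ) : ℝ≥0∞ :=
  ENNReal.ofReal (w x ^ (-(p / (p - 1))))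

lemma sW_meas {n : ℕ} (p : ℝ) {w : (Fin n → ℝ) → ℝ} (hw : Measurable w) : Measurable (sW p w) := by
  unfold sW; fun_prop

/-- the dual measure -/
def sM {n : ℕ} (p : ℝ) (w : (Fin n → ℝ) → ℝ) : Measure (Fin n → ℝ) :=
  (volume : Measure (Fin n → ℝ)).withDensity (sW p w)

lemma sM_ball {n : ℕ} (p : ℝ) (w : (Fin n → ℝ) → ℝ) (E : Set (Fin n → ℝ)) (hE : MeasurableSet E) :
    sM p w E = ∫⁻ x in E, sW p w x := withDensity_apply _ hE

lemma star_local {n : ℕ} {p q : ℝ} (hp : 1 < p) (hq : 0 < q) {w : (Fin n → ℝ) → ℝ}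
    {κ : ℝ} (hκ : κ = q * (1 - 1 / p)) (c : Fin n → ℝ) (r : ℝ) (hr : 0 < r) (t : ℝ) (ht : 0 < t) :
    ENNReal.ofReal t ^ q * volume (Metric.closedBall c r ∩ {x | t < w x}) *
        sM p w (Metric.closedBall c r) ^ κ ≤
      ApqStarConst n p q w ^ q * volume (Metric.closedBall c r) ^ (1 + κ) := by
  have hp0 : 0 < p := by linarith
  have h1p : 0 ≤ 1 - 1 / p := by
    have : 1 / p ≤ 1 := by rw [div_le_one hp0]; exact hp.le
    linarith
  have hκ0 : 0 ≤ κ := by rw [hκ]; positivity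
  rw [sM_ball _ _ _ Metric.isClosed_closedBall.measurableSet]
  set B := Metric.closedBall c r with hB
  set V := volume B with hV
  have hV0 : V ≠ 0 := vol_ne_zero c hr
  have hVt : V ≠ ∞ := vol_ne_top c r
  set S := ∫⁻ x in B, sW p w x with hS
  set N := wnormE n 1 (B.indicator fun x => ENNReal.ofReal (w x ^ q)) with hN
  have h1 : (V⁻¹ * N) ^ (1 / q) * (V⁻¹ * S) ^ (1 - 1 / p) ≤ ApqStarConst n p q w :=
    le_iSup₂_of_le (f := fun (Q : Set (Fin n → ℝ)) (_ : IsCube n Q) =>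
      ((volume Q)⁻¹ * wnormE n 1 (Q.indicator fun x => ENNReal.ofReal (w x ^ q))) ^ (1 / q) *
      ((volume Q)⁻¹ * ∫⁻ x in Q, ENNReal.ofReal (w x ^ (-(p / (p - 1))))) ^ (1 - 1 / p))
      B ((isCube_iff B).2 ⟨c, r, hr, rfl⟩) le_rfl
  have h2 : (V⁻¹ * N) * (V⁻¹ * S) ^ κ ≤ ApqStarConst n p q w ^ q := by
    have := ENNReal.rpow_le_rpow h1 hq.le
    rw [ENNReal.mul_rpow_of_nonneg _ _ hq.le, ← ENNReal.rpow_mul, ← ENNReal.rpow_mul,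
      one_div_mul_cancel hq.ne', ENNReal.rpow_one, mul_comm (1 - 1 / p), ← hκ] at this
    exact this
  have h3 : N * S ^ κ ≤ ApqStarConst n p q w ^ q * V ^ (1 + κ) := by
    have e : N * S ^ κ = ((V⁻¹ * N) * (V⁻¹ * S) ^ κ) * V ^ (1 + κ) := by
      rw [ENNReal.mul_rpow_of_nonneg _ _ hκ0, ENNReal.rpow_add _ _ hV0 hVt, ENNReal.rpow_one]
      have a1 : V⁻¹ * V = 1 := ENNReal.inv_mul_cancel hV0 hVt
      have a2 : V⁻¹ ^ κ * V ^ κ = 1 := by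
        rw [← ENNReal.mul_rpow_of_nonneg _ _ hκ0, a1, ENNReal.one_rpow]
      calc _ = (V⁻¹ * V) * (V⁻¹ ^ κ * V ^ κ) * (N * S ^ κ) := by rw [a1, a2, one_mul, one_mul]
        _ = _ := by ring
    rw [e]; gcongr
  refine le_trans ?_ h3
  gcongr
  have h4 : ENNReal.ofReal (t ^ q) * volume {x | ENNReal.ofReal (t ^ q) <
      B.indicator (fun x => ENNReal.ofReal (w x ^ q)) x} ^ ((1:ℝ) / 1) ≤ N :=
    le_iSup₂_of_le (f := fun (t : ℝ) (_ : 0 < t) => ENNReal.ofReal t * volume {x | ENNReal.ofReal t <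
      B.indicator (fun x => ENNReal.ofReal (w x ^ q)) x} ^ ((1:ℝ) / 1)) (t ^ q) (by positivity) le_rfl
  refine le_trans ?_ h4
  rw [div_one, ENNReal.rpow_one, ENNReal.ofReal_rpow_of_pos ht]
  gcongr
  rintro x ⟨hxB, hx⟩
  have hx' : t < w x := hx
  show ENNReal.ofReal (t ^ q) < _
  rw [indicator_of_mem hxB, ENNReal.ofReal_lt_ofReal_iff (by have := ht.trans hx'; positivity)]
  exact Real.rpow_lt_rpow ht.le hx' hq

lemma sW_pos {n : ℕ} (p : ℝ) {w : (Fin n → ℝ) → ℝ} {x : Fin n → ℝ} (h : 0 < w x) : sW p w x ≠ 0 := by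
  unfold sW
  simpa using Real.rpow_pos_of_pos h _

lemma sM_ne_zero {n : ℕ} (p : ℝ) {w : (Fin n → ℝ) → ℝ} (hwm : Measurable w)
    (hwpos : ∀ᵐ x ∂(volume : Measure (Fin n → ℝ)), 0 < w x) (c : Fin n → ℝ) (r : ℝ) (hr : 0 < r) :
    sM p w (Metric.closedBall c r) ≠ 0 := by
  rw [sM_ball _ _ _ Metric.isClosed_closedBall.measurableSet]
  intro h0
  rw [lintegral_eq_zero_iff (sW_meas p hwm)] at h0
  have h1 := ae_restrict_of_ae (s := Metric.closedBall c r) hwpos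
  have : ∀ᵐ x ∂(volume.restrict (Metric.closedBall c r)), False := by
    filter_upwards [h0, h1] with x hx hx1
    exact sW_pos p hx1 hx
  rw [Filter.eventually_false_iff_eq_bot, ae_eq_bot, Measure.restrict_eq_zero] at this
  exact vol_ne_zero c hr this

lemma sM_ne_top {n : ℕ} {p q κ : ℝ} (hκ0 : 0 < κ) {w : (Fin n → ℝ) → ℝ} {K : ℝ≥0∞} (hK : K ≠ ∞)
    (hwpos : ∀ᵐ x ∂(volume : Measure (Fin n → ℝ)), 0 < w x)
    (hA : ∀ c r, 0 < r → ∀ t : ℝ, 0 < t →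
      ENNReal.ofReal t ^ q * volume (Metric.closedBall c r ∩ {x | t < w x}) *
        sM p w (Metric.closedBall c r) ^ κ ≤ K * volume (Metric.closedBall c r) ^ (1 + κ))
    (c : Fin n → ℝ) (r : ℝ) (hr : 0 < r) : sM p w (Metric.closedBall c r) ≠ ∞ := by
  intro htop
  have h0 : ∀ t : ℝ, 0 < t → volume (Metric.closedBall c r ∩ {x | t < w x}) = 0 := by
    intro t ht
    by_contra hne
    have h := hA c r hr t ht
    rw [htop, ENNReal.top_rpow_of_pos hκ0, ENNReal.mul_top] at h
    · have : K * volume (Metric.closedBall c r) ^ (1 + κ) ≠ ∞ :=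
        ENNReal.mul_ne_top hK (ENNReal.rpow_ne_top_of_nonneg (by linarith) (vol_ne_top _ _))
      exact this (top_le_iff.1 h)
    · refine mul_ne_zero ?_ hne
      rw [ENNReal.ofReal_rpow_of_pos ht]
      simpa using Real.rpow_pos_of_pos ht _
  have h1 : volume (⋃ j : ℕ, Metric.closedBall c r ∩ {x | 1 / ((j:ℝ) + 1) < w x}) = 0 :=
    measure_iUnion_null fun j => h0 _ (by positivity)
  refine vol_ne_zero c hr (le_antisymm ?_ (zero_le))
  rw [← h1]
  refine measure_mono_ae ?_
  filter_upwards [hwpos] with x hx hxB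
  obtain ⟨j, hj⟩ := exists_nat_one_div_lt hx
  exact mem_iUnion.2 ⟨j, hxB, hj⟩

lemma ainf {n : ℕ} {p q κ : ℝ} (hp : 1 < p) (hq : 0 < q) (hκ : κ = q * (1 - 1 / p))
    {w : (Fin n → ℝ) → ℝ} {K : ℝ≥0∞} (hK0 : K ≠ 0) (hK : K ≠ ∞) (hwm : Measurable w)
    (hwpos : ∀ᵐ x ∂(volume : Measure (Fin n → ℝ)), 0 < w x)
    (hA : ∀ c r, 0 < r → ∀ t : ℝ, 0 < t →
      ENNReal.ofReal t ^ q * volume (Metric.closedBall c r ∩ {x | t < w x}) *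
        sM p w (Metric.closedBall c r) ^ κ ≤ K * volume (Metric.closedBall c r) ^ (1 + κ))
    (L : ℝ≥0∞) (hL0 : L ≠ 0) (hLt : L ≠ ∞)
    (c : Fin n → ℝ) (r : ℝ) (hr : 0 < r) (hSt : sM p w (Metric.closedBall c r) ≠ ∞)
    (E : Set (Fin n → ℝ)) (hE : MeasurableSet E) (hEB : E ⊆ Metric.closedBall c r)
    (hLE : volume (Metric.closedBall c r) ≤ L * volume E) :
    sM p w (Metric.closedBall c r) ≤
      ((2 * L * K) ^ ((p / (p - 1)) / q) * (2 * L)) * sM p w E := by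
  have hp0 : 0 < p := by linarith
  have hp1 : 0 < p - 1 := by linarith
  set p' := p / (p - 1) with hp'
  have hp'0 : 0 < p' := by positivity
  have hpp : 1 - 1 / p = 1 / p' := by rw [hp']; field_simp
  have hκ0 : 0 ≤ κ := by rw [hκ, hpp]; positivity
  have hS0 := sM_ne_zero p hwm hwpos c r hr
  have hAc := hA c r hr
  set B := Metric.closedBall c r with hB
  set b := volume B with hb
  have hb0 : b ≠ 0 := vol_ne_zero c hr
  have hbt : b ≠ ∞ := vol_ne_top c r
  set S := sM p w B with hS
  set Y := 2 * L * K with hY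
  have hY0 : Y ≠ 0 := mul_ne_zero (mul_ne_zero (by norm_num) hL0) hK0
  have hYt : Y ≠ ∞ := ENNReal.mul_ne_top (ENNReal.mul_ne_top (by norm_num) hLt) hK
  have hbS0 : b / S ≠ 0 := ENNReal.div_ne_zero.2 ⟨hb0, hSt⟩
  have hbSt : b / S ≠ ∞ := ENNReal.div_ne_top hbt hS0
  set τ := Y ^ (1 / q) * (b / S) ^ (1 / p') with hτ
  have hτ0 : τ ≠ 0 := by
    refine mul_ne_zero ?_ ?_ <;> simp [ENNReal.rpow_eq_zero_iff, hY0, hYt, hbS0, hbSt]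
  have hτt : τ ≠ ∞ :=
    ENNReal.mul_ne_top (ENNReal.rpow_ne_top_of_nonneg (by positivity) hYt)
      (ENNReal.rpow_ne_top_of_nonneg (by positivity) hbSt)
  have hτq : τ ^ q = Y * (b / S) ^ κ := by
    rw [hτ, ENNReal.mul_rpow_of_nonneg _ _ hq.le, ← ENNReal.rpow_mul, ← ENNReal.rpow_mul,
      one_div_mul_cancel hq.ne', ENNReal.rpow_one, hκ, hpp, mul_comm q]
  have hτp : τ ^ p' = Y ^ (p' / q) * (b / S) := by
    rw [hτ, ENNReal.mul_rpow_of_nonneg _ _ hp'0.le, ← ENNReal.rpow_mul, ← ENNReal.rpow_mul,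
      one_div_mul_cancel hp'0.ne', ENNReal.rpow_one, one_div_mul_eq_div]
  have ht : 0 < τ.toReal := ENNReal.toReal_pos hτ0 hτt
  set U := {x | τ.toReal < w x} with hU
  have hUm : MeasurableSet U := measurableSet_lt measurable_const hwm
  set v := volume (B ∩ U) with hv
  have h1 := hAc _ ht
  rw [ENNReal.ofReal_toReal hτt, hτq] at h1
  have h2 : 2 * L * v ≤ b := by
    have hbk0 : b ^ κ ≠ 0 := by simp [ENNReal.rpow_eq_zero_iff, hb0, hbt]
    have hbkt : b ^ κ ≠ ∞ := ENNReal.rpow_ne_top_of_nonneg hκ0 hbt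
    refine (ENNReal.mul_le_mul_iff_right (mul_ne_zero hK0 hbk0) (ENNReal.mul_ne_top hK hbkt)).1 ?_
    calc K * b ^ κ * (2 * L * v) = Y * b ^ κ * v := by rw [hY]; ring
      _ = Y * (b / S) ^ κ * v * S ^ κ := by
          have : b ^ κ = (b / S) ^ κ * S ^ κ := by
            rw [← ENNReal.mul_rpow_of_nonneg _ _ hκ0, ENNReal.div_mul_cancel hS0 hSt]
          rw [this]; ring
      _ ≤ K * b ^ (1 + κ) := h1
      _ = K * b ^ κ * b := by
          rw [ENNReal.rpow_add _ _ hb0 hbt, ENNReal.rpow_one]; ring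
  have h3 : 2 * v ≤ volume E := by
    refine (ENNReal.mul_le_mul_iff_right hL0 hLt).1 ?_
    calc L * (2 * v) = 2 * L * v := by ring
      _ ≤ _ := h2.trans hLE
  have hEt : volume E ≠ ∞ := ((measure_mono hEB).trans_lt hbt.lt_top).ne
  have h4 : volume E ≤ 2 * volume (E \ U) := by
    have h5 : volume E ≤ v + volume (E \ U) := by
      refine (measure_le_inter_add_sdiff volume E U).trans ?_
      gcongr
      exact measure_mono (inter_subset_inter_left _ hEB)
    have : volume E + volume E ≤ volume E + 2 * volume (E \ U) := by
      calc volume E + volume E ≤ (v + volume (E \ U)) + (v + volume (E \ U)) := by gcongr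
        _ = 2 * v + 2 * volume (E \ U) := by ring
        _ ≤ _ := by gcongr
    exact (ENNReal.add_le_add_iff_left hEt).1 this
  have h6 : volume (E \ U) ≤ τ ^ p' * sM p w E := by
    rw [sM_ball _ _ _ hE]
    calc volume (E \ U) = ∫⁻ x in E \ U, 1 := by simp
      _ ≤ ∫⁻ x in E \ U, τ ^ p' * sW p w x := by
          refine lintegral_mono_ae ?_
          filter_upwards [ae_restrict_of_ae (s := E \ U) hwpos,
            self_mem_ae_restrict (hE.diff hUm)] with x hx hxU
          have hxw : w x ≤ τ.toReal := not_lt.1 hxU.2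
          have e1 : τ ^ p' = ENNReal.ofReal (τ.toReal ^ p') := by
            rw [← ENNReal.ofReal_rpow_of_pos ht, ENNReal.ofReal_toReal hτt]
          rw [e1]
          unfold sW
          rw [← ENNReal.ofReal_mul (by positivity), ← ENNReal.ofReal_one]
          apply ENNReal.ofReal_le_ofReal
          rw [Real.rpow_neg hx.le, ← div_eq_mul_inv, one_le_div (by positivity)]
          exact Real.rpow_le_rpow hx.le hxw hp'0.le
      _ = τ ^ p' * ∫⁻ x in E \ U, sW p w x := lintegral_const_mul _ (sW_meas p hwm)
      _ ≤ _ := by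
          gcongr
          exact sdiff_subset
  have h7 : b ≤ L * (2 * (Y ^ (p' / q) * (b / S) * sM p w E)) := by
    rw [← hτp]
    refine hLE.trans ?_
    gcongr
    exact h4.trans (by gcongr)
  calc S = S / b * b := (ENNReal.div_mul_cancel hb0 hbt).symm
    _ ≤ S / b * (L * (2 * (Y ^ (p' / q) * (b / S) * sM p w E))) := by gcongr
    _ = (S / b * (b / S)) * (Y ^ (p' / q) * (2 * L) * sM p w E) := by ring
    _ = _ := by
        have : S / b * (b / S) = 1 := by
          rw [div_eq_mul_inv, div_eq_mul_inv]
          calc _ = (S * S⁻¹) * (b⁻¹ * b) := by ring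
            _ = 1 := by rw [ENNReal.mul_inv_cancel hS0 hSt, ENNReal.inv_mul_cancel hb0 hbt, one_mul]
        rw [this, one_mul]

lemma dens_set {n : ℕ} (p : ℝ) {w : (Fin n → ℝ) → ℝ} (hwm : Measurable w)
    (hwpos : ∀ᵐ x ∂(volume : Measure (Fin n → ℝ)), 0 < w x)
    {F : (Fin n → ℝ) → ℝ≥0∞} (hF : Measurable F) (E : Set (Fin n → ℝ)) (hE : MeasurableSet E) :
    ∫⁻ y in E, F y / sW p w y ∂(sM p w) = ∫⁻ y in E, F y := by
  have hg : Measurable fun y => F y / sW p w y := hF.div (sW_meas p hwm)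
  unfold sM
  rw [setLIntegral_withDensity_eq_setLIntegral_mul _ (sW_meas p hwm) hg hE]
  apply lintegral_congr_ae
  filter_upwards [ae_restrict_of_ae (s := E) hwpos] with x hx
  simp only [Pi.mul_apply]
  exact ENNReal.mul_div_cancel (sW_pos p hx) ENNReal.ofReal_ne_top

lemma dens_pow {n : ℕ} {p : ℝ} (hp : 1 < p) {w : (Fin n → ℝ) → ℝ} (hwm : Measurable w)
    (hwpos : ∀ᵐ x ∂(volume : Measure (Fin n → ℝ)), 0 < w x)
    {F : (Fin n → ℝ) → ℝ≥0∞} (hF : Measurable F) (f : (Fin n → ℝ) → ℝ)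
    (hFf : ∀ x, F x ≤ ENNReal.ofReal |f x|) :
    ∫⁻ y, (F y / sW p w y) ^ p ∂(sM p w) ≤ ∫⁻ x, ENNReal.ofReal (|f x| ^ p * w x ^ p) := by
  have hp0 : 0 < p := by linarith
  have hp1 : p - 1 ≠ 0 := by linarith
  have hg : Measurable fun y => (F y / sW p w y) ^ p := (hF.div (sW_meas p hwm)).pow_const p
  unfold sM
  rw [lintegral_withDensity_eq_lintegral_mul _ (sW_meas p hwm) hg]
  apply lintegral_mono_ae
  filter_upwards [hwpos] with x hx
  simp only [Pi.mul_apply]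
  have hs : 0 < w x ^ (-(p / (p - 1))) := Real.rpow_pos_of_pos hx _
  calc sW p w x * (F x / sW p w x) ^ p
      ≤ sW p w x * (ENNReal.ofReal |f x| / sW p w x) ^ p := by
        gcongr
        exact hFf x
    _ = ENNReal.ofReal (w x ^ (-(p / (p - 1))) * (|f x| / w x ^ (-(p / (p - 1)))) ^ p) := by
        unfold sW
        rw [← ENNReal.ofReal_div_of_pos hs, ENNReal.ofReal_rpow_of_nonneg (by positivity) hp0.le,
          ← ENNReal.ofReal_mul hs.le]
    _ = _ := by
        congr 1
        rw [Real.div_rpow (abs_nonneg _) hs.le, ← Real.rpow_mul hx.le]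
        have : w x ^ p * w x ^ (-(p / (p - 1)) * p) = w x ^ (-(p / (p - 1))) := by
          rw [← Real.rpow_add hx]
          congr 1
          field_simp
          ring
        have h2 : w x ^ (-(p / (p - 1)) * p) ≠ 0 := (Real.rpow_pos_of_pos hx _).ne'
        rw [← this]
        field_simp

/-- truncation -/
def trunc {n : ℕ} (F : (Fin n → ℝ) → ℝ≥0∞) (N : ℕ) : (Fin n → ℝ) → ℝ≥0∞ :=
  (Metric.closedBall (0 : Fin n → ℝ) N).indicator fun x => min (F x) N

lemma trunc_meas {n : ℕ} {F : (Fin n → ℝ) → ℝ≥0∞} (hF : Measurable F) (N : ℕ) :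
    Measurable (trunc F N) :=
  (hF.min measurable_const).indicator Metric.isClosed_closedBall.measurableSet

lemma trunc_le {n : ℕ} (F : (Fin n → ℝ) → ℝ≥0∞) (N : ℕ) (x) : trunc F N x ≤ F x := by
  unfold trunc
  exact indicator_le' (fun _ _ => min_le_left _ _) (fun _ _ => zero_le) x

lemma trunc_le_nat {n : ℕ} (F : (Fin n → ℝ) → ℝ≥0∞) (N : ℕ) (x) : trunc F N x ≤ N := by
  unfold trunc
  exact indicator_le' (f := fun x => min (F x) N) (g := fun _ => (N : ℝ≥0∞))
    (fun _ _ => min_le_right _ _) (fun _ _ => zero_le) x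

lemma trunc_int {n : ℕ} (F : (Fin n → ℝ) → ℝ≥0∞) (N : ℕ) : ∫⁻ x, trunc F N x ≠ ∞ := by
  unfold trunc
  rw [lintegral_indicator Metric.isClosed_closedBall.measurableSet]
  have : ∫⁻ x in Metric.closedBall (0 : Fin n → ℝ) N, min (F x) N ≤
      ∫⁻ x in Metric.closedBall (0 : Fin n → ℝ) N, (N : ℝ≥0∞) :=
    lintegral_mono fun x => min_le_right _ _
  rw [setLIntegral_const] at this
  exact (this.trans_lt (ENNReal.mul_lt_top (ENNReal.natCast_lt_top N) (vol_ne_top _ _).lt_top)).ne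

lemma trunc_mono {n : ℕ} (F : (Fin n → ℝ) → ℝ≥0∞) : Monotone (trunc F) := by
  intro a b hab x
  unfold trunc
  have hab' : (a : ℝ) ≤ b := by exact_mod_cast hab
  have hab2 : (a : ℝ≥0∞) ≤ b := by exact_mod_cast hab
  refine (indicator_le_indicator_of_subset (Metric.closedBall_subset_closedBall hab')
    (fun _ => zero_le) x).trans (indicator_le_indicator ?_)
  exact min_le_min le_rfl hab2

lemma trunc_sup {n : ℕ} (F : (Fin n → ℝ) → ℝ≥0∞) (hF : ∀ x, F x ≠ ∞) (x) :
    ⨆ N, trunc F N x = F x := by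
  apply le_antisymm (iSup_le fun N => trunc_le F N x)
  obtain ⟨N1, h1⟩ := ENNReal.exists_nat_gt (hF x)
  obtain ⟨N2, h2⟩ := exists_nat_ge (dist x 0)
  refine le_iSup_of_le (max N1 N2) ?_
  unfold trunc
  rw [indicator_of_mem]
  · refine le_min le_rfl (h1.le.trans ?_)
    exact_mod_cast le_max_left _ _
  · rw [Metric.mem_closedBall]
    refine h2.trans ?_
    exact_mod_cast le_max_right _ _

lemma suff (n : ℕ) (hn : 1 ≤ n) (β p q κ : ℝ) (hp : 1 < p) (hpq : p ≤ q)
    (hκ : κ = q * (1 - 1 / p)) (hβ0 : 0 ≤ β) (hβ1 : β < 1)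
    (hβ : q * (β - 1) + 1 + κ = 0)
    (w : (Fin n → ℝ) → ℝ) (hwm : Measurable w)
    (hwpos : ∀ᵐ x ∂(volume : Measure (Fin n → ℝ)), 0 < w x)
    (hS : ApqStarConst n p q w < ∞) :
    ∃ C : ℝ≥0∞, C ≠ ∞ ∧ ∀ f : (Fin n → ℝ) → ℝ, Measurable f → ∀ t : ℝ, 0 < t →
      ENNReal.ofReal t ^ q * volume {x | ENNReal.ofReal t <
        ENNReal.ofReal (w x) * Mx β (fun y => ENNReal.ofReal |f y|) x} ≤
      C * (∫⁻ x, ENNReal.ofReal (|f x| ^ p * w x ^ p)) ^ (q / p) := by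
  have hp0 : 0 < p := by linarith
  have hq0 : 0 < q := by linarith
  have h1p : 0 < 1 - 1 / p := by
    have : 1 / p < 1 := by rw [div_lt_one hp0]; exact hp
    linarith
  have hκ0 : 0 < κ := by rw [hκ]; positivity
  obtain ⟨K, hKdef⟩ : ∃ K, K = ApqStarConst n p q w ^ q + 1 := ⟨_, rfl⟩
  have hK0 : K ≠ 0 := by rw [hKdef]; simp
  have hKt : K ≠ ∞ := by
    rw [hKdef]
    exact ENNReal.add_ne_top.2 ⟨ENNReal.rpow_ne_top_of_nonneg hq0.le hS.ne, ENNReal.one_ne_top⟩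
  have hA : ∀ c r, 0 < r → ∀ t : ℝ, 0 < t →
      ENNReal.ofReal t ^ q * volume (Metric.closedBall c r ∩ {x | t < w x}) *
        sM p w (Metric.closedBall c r) ^ κ ≤ K * volume (Metric.closedBall c r) ^ (1 + κ) := by
    intro c r hr t ht
    refine (star_local hp hq0 hκ c r hr t ht).trans ?_
    gcongr
    rw [hKdef]
    exact le_self_add
  have hfin : ∀ c r, 0 < r → sM p w (Metric.closedBall c r) ≠ ∞ :=
    sM_ne_top hκ0 hKt hwpos hA
  have hpos := sM_ne_zero p hwm hwpos
  have : SFinite (sM p w) := by unfold sM; infer_instance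
  have hc : ∀ L : ℝ≥0∞, L ≠ ∞ → ((2 * L * K) ^ ((p / (p - 1)) / q) * (2 * L)) ≠ ∞ := by
    intro L hL
    have : 0 ≤ (p / (p - 1)) / q := by
      have : 0 < p - 1 := by linarith
      positivity
    exact ENNReal.mul_ne_top (ENNReal.rpow_ne_top_of_nonneg this
      (ENNReal.mul_ne_top (ENNReal.mul_ne_top (by simp) hL) hKt)) (ENNReal.mul_ne_top (by simp) hL)
  obtain ⟨C2, hC2t, hC2⟩ : ∃ C2 : ℝ≥0∞, C2 ≠ ∞ ∧ ∀ c r, 0 < r → ∀ E, MeasurableSet E →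
      E ⊆ Metric.closedBall c r → volume (Metric.closedBall c r) ≤ 2 * volume E →
      sM p w (Metric.closedBall c r) ≤ C2 * sM p w E :=
    ⟨_, hc 2 (by simp), fun c r hr E hE hEB h =>
      ainf hp hq0 hκ hK0 hKt hwm hwpos hA 2 (by simp) (by simp) c r hr (hfin c r hr) E hE hEB h⟩
  obtain ⟨D, hDt, hD⟩ : ∃ D : ℝ≥0∞, D ≠ ∞ ∧ ∀ c r, 0 < r →
      sM p w (Metric.closedBall c (5 * r)) ≤ D * sM p w (Metric.closedBall c r) := by
    refine ⟨_, hc (ENNReal.ofReal 5 ^ n) (by simp), fun c r hr =>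
      ainf hp hq0 hκ hK0 hKt hwm hwpos hA (ENNReal.ofReal 5 ^ n) (by simp) (by simp) c (5 * r)
        (by positivity) (hfin c _ (by positivity)) _ Metric.isClosed_closedBall.measurableSet
        (Metric.closedBall_subset_closedBall (by linarith)) ?_⟩
    exact (vol_scale c c hr (by norm_num)).le
  obtain ⟨m, hm⟩ : ∃ m : ℕ, 2 * 15 ^ n ≤ 2 ^ m := ⟨2 * 15 ^ n, Nat.lt_two_pow_self.le⟩
  have hq_p : 0 ≤ q / p := by positivity
  refine ⟨(2^q*K*(5^n)^(1+κ)) * (C2*(((m+1:ℕ):ℝ≥0∞) *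
    (ENNReal.ofReal p*(2*D)*2^(p-1)*ENNReal.ofReal (1/(p-1)))))^(q/p), ?_, ?_⟩
  · have h2 : (2 : ℝ≥0∞) ≠ ∞ := by simp
    refine ENNReal.mul_ne_top (ENNReal.mul_ne_top (ENNReal.mul_ne_top
      (ENNReal.rpow_ne_top_of_nonneg hq0.le h2) hKt)
      (ENNReal.rpow_ne_top_of_nonneg (by linarith) (by simp)))
      (ENNReal.rpow_ne_top_of_nonneg hq_p (ENNReal.mul_ne_top hC2t (ENNReal.mul_ne_top (by simp)
        (ENNReal.mul_ne_top (ENNReal.mul_ne_top (ENNReal.mul_ne_top (by simp)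
          (ENNReal.mul_ne_top h2 hDt)) (ENNReal.rpow_ne_top_of_nonneg (by linarith) h2))
          (by simp)))))
  intro f hf t ht
  set F : (Fin n → ℝ) → ℝ≥0∞ := fun y => ENNReal.ofReal |f y| with hF
  have hFm : Measurable F := by rw [hF]; fun_prop
  set I := ∫⁻ x, ENNReal.ofReal (|f x| ^ p * w x ^ p) with hI
  have key : ∀ N : ℕ, ENNReal.ofReal t ^ q * volume {x | ENNReal.ofReal t <
        ENNReal.ofReal (w x) * Mx β (trunc F N) x} ≤
      (2^q*K*(5^n)^(1+κ)) * (C2*(((m+1:ℕ):ℝ≥0∞) *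
    (ENNReal.ofReal p*(2*D)*2^(p-1)*ENNReal.ofReal (1/(p-1)))))^(q/p) * I ^ (q / p) := by
    intro N
    have hgm := trunc_meas hFm N
    refine (main_nice n hn β p q κ hp hpq hκ hβ0 hβ1 hβ w (sM p w) D K C2 hD hfin hpos hA hC2 m hm
      (trunc F N) (fun y => trunc F N y / sW p w y) (hgm.div (sW_meas p hwm)) (trunc_int F N)
      N (by simp) (trunc_le_nat F N)
      (fun c r => dens_set p hwm hwpos hgm _ Metric.isClosed_closedBall.measurableSet)
      ?_ t ht).trans ?_
    · have := dens_set p hwm hwpos hgm univ MeasurableSet.univ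
      rw [Measure.restrict_univ, Measure.restrict_univ] at this
      rw [this]
      exact trunc_int F N
    · rw [mul_assoc (2^q*K*(5^n)^(1+κ)), ← ENNReal.mul_rpow_of_nonneg _ _ hq_p, mul_assoc C2]
      gcongr
      exact dens_pow hp hwm hwpos hgm f (trunc_le F N)
  have hmono : Monotone fun N : ℕ => {x | ENNReal.ofReal t <
        ENNReal.ofReal (w x) * Mx β (trunc F N) x} := by
    intro a b hab x hx
    simp only [mem_ofPred_eq] at hx ⊢
    refine hx.trans_le ?_
    gcongr
    unfold Mx avA
    gcongr
    exact trunc_mono F hab _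
  have hsub : {x | ENNReal.ofReal t < ENNReal.ofReal (w x) * Mx β F x} ⊆
      ⋃ N : ℕ, {x | ENNReal.ofReal t < ENNReal.ofReal (w x) * Mx β (trunc F N) x} := by
    intro x hx
    simp only [mem_ofPred_eq, mem_iUnion] at hx ⊢
    unfold Mx at hx
    simp only [ENNReal.mul_iSup, lt_iSup_iff] at hx
    obtain ⟨c, r, hr, hxB, hx⟩ := hx
    have : avA β F c r = ⨆ N, avA β (trunc F N) c r := by
      unfold avA
      rw [← ENNReal.mul_iSup, ← ENNReal.mul_iSup, ← lintegral_iSup (trunc_meas hFm) (trunc_mono F)]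
      simp_rw [trunc_sup F (fun x => ENNReal.ofReal_ne_top)]
    rw [this, ENNReal.mul_iSup, lt_iSup_iff] at hx
    obtain ⟨N, hN⟩ := hx
    exact ⟨N, hN.trans_le (by gcongr; exact le_Mx β _ hr hxB)⟩
  calc _ ≤ ENNReal.ofReal t ^ q * volume (⋃ N : ℕ, {x | ENNReal.ofReal t < ENNReal.ofReal (w x) * Mx β (trunc F N) x}) := by
        gcongr
    _ ≤ _ := by
        rw [hmono.measure_iUnion, ENNReal.mul_iSup]
        exact iSup_le key

lemma nec_local (n : ℕ) (β p q : ℝ) (hp : 1 < p) (hq0 : 0 < q)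
    (w : (Fin n → ℝ) → ℝ) (hwm : Measurable w)
    (hwpos : ∀ᵐ x ∂(volume : Measure (Fin n → ℝ)), 0 < w x) (C : ℝ≥0∞)
    (h : ∀ f : (Fin n → ℝ) → ℝ, Measurable f →
      (∫⁻ x, ENNReal.ofReal (|f x| ^ p * w x ^ p)) < ∞ → ∀ t : ℝ, 0 < t →
      ENNReal.ofReal t * volume {x | ENNReal.ofReal t <
        ENNReal.ofReal (w x) * Mx β (fun y => ENNReal.ofReal |f y|) x} ^ (1 / q) ≤
      C * (∫⁻ x, ENNReal.ofReal (|f x| ^ p * w x ^ p)) ^ (1 / p))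
    (c : Fin n → ℝ) (r : ℝ) (hr : 0 < r) (t : ℝ) (ht : 0 < t) :
    ENNReal.ofReal t * volume (Metric.closedBall c r ∩ {x | t < w x}) ^ (1 / q) *
      volume (Metric.closedBall c r) ^ (β - 1) * sM p w (Metric.closedBall c r) ^ (1 - 1 / p)
      ≤ C := by
  have hp0 : 0 < p := by linarith
  have hp1 : p - 1 ≠ 0 := by linarith
  have h1p : 0 < 1 - 1 / p := by
    have : 1 / p < 1 := by rw [div_lt_one hp0]; exact hp
    linarith
  set B := Metric.closedBall c r with hB
  set V := volume B with hV
  have hV0 : V ≠ 0 := vol_ne_zero c hr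
  have hVt : V ≠ ∞ := vol_ne_top c r
  have hBm : MeasurableSet B := Metric.isClosed_closedBall.measurableSet
  set U : ℕ → Set (Fin n → ℝ) := fun k => B ∩ {x | 1 / ((k : ℝ) + 1) < w x} with hU
  have hUm : ∀ k, MeasurableSet (U k) := fun k => hBm.inter (measurableSet_lt measurable_const hwm)
  have hUmono : Monotone U := by
    intro a b hab x hx
    refine ⟨hx.1, ?_⟩
    have hx2 : 1 / ((a : ℝ) + 1) < w x := hx.2
    change 1 / ((b : ℝ) + 1) < w x
    refine lt_of_le_of_lt ?_ hx2
    have : (a : ℝ) ≤ b := by exact_mod_cast hab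
    exact one_div_le_one_div_of_le (by positivity) (by linarith)
  have hUU : sM p w (⋃ k, U k) = sM p w B := by
    apply measure_congr
    have hac : sM p w ≪ volume := withDensity_absolutelyContinuous _ _
    refine hac.ae_le ?_
    filter_upwards [hwpos] with x hx
    apply propext
    change x ∈ (⋃ k, U k) ↔ x ∈ B
    rw [mem_iUnion]
    constructor
    · rintro ⟨k, hk⟩
      exact hk.1
    · intro hxB
      obtain ⟨k, hk⟩ := exists_nat_one_div_lt hx
      exact ⟨k, hxB, hk⟩
  have hvt : volume (B ∩ {x | t < w x}) ≠ ∞ :=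
    ((measure_mono inter_subset_left).trans_lt hVt.lt_top).ne
  have hconst : ENNReal.ofReal t * volume (B ∩ {x | t < w x}) ^ (1 / q) * V ^ (β - 1) ≠ ∞ :=
    ENNReal.mul_ne_top (ENNReal.mul_ne_top ENNReal.ofReal_ne_top
      (ENNReal.rpow_ne_top_of_nonneg (by positivity) hvt))
      (ENNReal.rpow_ne_top_of_ne_zero hV0 hVt)
  have key : ∀ k, ENNReal.ofReal t * volume (B ∩ {x | t < w x}) ^ (1 / q) * V ^ (β - 1) *
      sM p w (U k) ^ (1 - 1 / p) ≤ C := by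
    intro k
    have hk0 : 0 < 1 / ((k : ℝ) + 1) := by positivity
    set S := sM p w (U k) with hS
    have hSe : S = ∫⁻ x in U k, sW p w x := sM_ball _ _ _ (hUm k)
    have hSt : S ≠ ∞ := by
      rw [hSe]
      have : ∫⁻ x in U k, sW p w x ≤
          ∫⁻ x in U k, ENNReal.ofReal ((1 / ((k : ℝ) + 1)) ^ (-(p / (p - 1)))) := by
        refine setLIntegral_mono' (hUm k) fun x hx => ?_
        unfold sW
        apply ENNReal.ofReal_le_ofReal
        apply Real.rpow_le_rpow_of_nonpos hk0 (le_of_lt hx.2)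
        have : 0 < p - 1 := by linarith
        have : 0 < p / (p - 1) := by positivity
        linarith
      rw [setLIntegral_const] at this
      refine (this.trans_lt (ENNReal.mul_lt_top ENNReal.ofReal_lt_top ?_)).ne
      exact (measure_mono inter_subset_left).trans_lt hVt.lt_top
    by_cases hS0 : S = 0
    · rw [hS0, ENNReal.zero_rpow_of_pos h1p]; simp
    set f : (Fin n → ℝ) → ℝ := (U k).indicator fun x => w x ^ (-(p / (p - 1))) with hf
    have hfm : Measurable f := (hwm.pow_const _).indicator (hUm k)
    have hfI : ∫⁻ x, ENNReal.ofReal (|f x| ^ p * w x ^ p) = S := by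
      rw [hSe, ← lintegral_indicator (hUm k)]
      congr 1
      ext x
      by_cases hx : x ∈ U k
      · have hw : 0 < w x := hk0.trans hx.2
        rw [hf, indicator_of_mem hx, indicator_of_mem hx]
        unfold sW
        congr 1
        rw [abs_of_pos (Real.rpow_pos_of_pos hw _), ← Real.rpow_mul hw.le, ← Real.rpow_add hw]
        congr 1
        field_simp
        ring
      · rw [hf, indicator_of_notMem hx, indicator_of_notMem hx, abs_zero, Real.zero_rpow hp0.ne']
        simp
    have hfB : ∫⁻ x in B, ENNReal.ofReal |f x| = S := by
      have : (fun x => ENNReal.ofReal |f x|) = (U k).indicator (sW p w) := by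
        ext x
        by_cases hx : x ∈ U k
        · have hw : 0 < w x := hk0.trans hx.2
          rw [hf, indicator_of_mem hx, indicator_of_mem hx]
          unfold sW
          rw [abs_of_pos (Real.rpow_pos_of_pos hw _)]
        · rw [hf, indicator_of_notMem hx, indicator_of_notMem hx]
          simp
      rw [this, setLIntegral_indicator (hUm k), inter_eq_left.2 inter_subset_left, hSe]
    have hav : avA β (fun y => ENNReal.ofReal |f y|) c r = V ^ (β - 1) * S := by
      unfold avA
      rw [hfB, ENNReal.rpow_sub _ _ hV0 hVt, ENNReal.rpow_one, div_eq_mul_inv, mul_assoc]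
    set a := V ^ (β - 1) * S with ha
    have hat : a ≠ ∞ := ENNReal.mul_ne_top (ENNReal.rpow_ne_top_of_ne_zero hV0 hVt) hSt
    have ha0 : a ≠ 0 := mul_ne_zero (ENNReal.rpow_pos (pos_iff_ne_zero.2 hV0) hVt).ne' hS0
    have hτ : 0 < t * a.toReal := mul_pos ht (ENNReal.toReal_pos ha0 hat)
    have h1 := h f hfm (by rw [hfI]; exact hSt.lt_top) (t * a.toReal) hτ
    rw [hfI, ENNReal.ofReal_mul ht.le, ENNReal.ofReal_toReal hat] at h1
    have hsub : B ∩ {x | t < w x} ⊆ {x | ENNReal.ofReal t * a <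
        ENNReal.ofReal (w x) * Mx β (fun y => ENNReal.ofReal |f y|) x} := by
      rintro x ⟨hxB, hx⟩
      simp only [mem_ofPred_eq] at hx ⊢
      calc ENNReal.ofReal t * a < ENNReal.ofReal (w x) * a := by
            rw [ENNReal.mul_lt_mul_iff_left ha0 hat]
            exact (ENNReal.ofReal_lt_ofReal_iff (ht.trans hx)).2 hx
        _ ≤ _ := by
            gcongr
            rw [← hav]
            exact le_Mx β _ hr hxB
    have h2 : ENNReal.ofReal t * a * volume (B ∩ {x | t < w x}) ^ (1 / q) ≤ C * S ^ (1 / p) :=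
      le_trans (by gcongr) h1
    have hSp0 : S ^ (1 / p) ≠ 0 := (ENNReal.rpow_pos (pos_iff_ne_zero.2 hS0) hSt).ne'
    have hSpt : S ^ (1 / p) ≠ ∞ := ENNReal.rpow_ne_top_of_ne_zero hS0 hSt
    refine (ENNReal.mul_le_mul_iff_left hSp0 hSpt).1 (le_trans (le_of_eq ?_) h2)
    have : S ^ (1 - 1 / p) * S ^ (1 / p) = S := by
      rw [← ENNReal.rpow_add _ _ hS0 hSt]; simp
    calc _ = ENNReal.ofReal t * volume (B ∩ {x | t < w x}) ^ (1 / q) * V ^ (β - 1) *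
          (S ^ (1 - 1 / p) * S ^ (1 / p)) := by ring
      _ = _ := by rw [this, ha]; ring
  have hlim := tendsto_measure_iUnion_atTop (μ := sM p w) hUmono
  rw [hUU] at hlim
  have hlim2 := ENNReal.Tendsto.const_mul
    ((ENNReal.continuous_rpow_const (y := 1 - 1 / p)).continuousAt.tendsto.comp hlim)
    (Or.inr hconst)
  exact le_of_tendsto' hlim2 key

lemma nec (n : ℕ) (β p q : ℝ) (hp : 1 < p) (hq0 : 0 < q)
    (hβ : β - 1 = -(1 / q) - (1 - 1 / p))
    (w : (Fin n → ℝ) → ℝ) (hwm : Measurable w) (hw0 : ∀ x, 0 ≤ w x)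
    (hwpos : ∀ᵐ x ∂(volume : Measure (Fin n → ℝ)), 0 < w x) (C : ℝ≥0∞)
    (h : ∀ f : (Fin n → ℝ) → ℝ, Measurable f →
      (∫⁻ x, ENNReal.ofReal (|f x| ^ p * w x ^ p)) < ∞ → ∀ t : ℝ, 0 < t →
      ENNReal.ofReal t * volume {x | ENNReal.ofReal t <
        ENNReal.ofReal (w x) * Mx β (fun y => ENNReal.ofReal |f y|) x} ^ (1 / q) ≤
      C * (∫⁻ x, ENNReal.ofReal (|f x| ^ p * w x ^ p)) ^ (1 / p)) :
    ApqStarConst n p q w ≤ C := by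
  have hp0 : 0 < p := by linarith
  have h1p : 0 < 1 - 1 / p := by
    have : 1 / p < 1 := by rw [div_lt_one hp0]; exact hp
    linarith
  have hq1 : 0 < 1 / q := by positivity
  unfold ApqStarConst
  refine iSup_le fun Q => iSup_le fun hQ => ?_
  obtain ⟨c, r, hr, rfl⟩ := (isCube_iff Q).1 hQ
  have hloc := nec_local n β p q hp hq0 w hwm hwpos C h c r hr
  have hS : sM p w (Metric.closedBall c r) = ∫⁻ x in Metric.closedBall c r, ENNReal.ofReal (w x ^ (-(p / (p - 1)))) :=
    sM_ball _ _ _ Metric.isClosed_closedBall.measurableSet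
  rw [← hS]
  set B := Metric.closedBall c r with hB
  set V := volume B with hV
  set S := sM p w B
  have hV0 : V ≠ 0 := vol_ne_zero c hr
  have hVt : V ≠ ∞ := vol_ne_top c r
  set N := wnormE n 1 (B.indicator fun x => ENNReal.ofReal (w x ^ q)) with hN
  obtain ⟨Z, hZ⟩ : ∃ Z, Z = V ^ (β - 1) * S ^ (1 - 1 / p) := ⟨_, rfl⟩
  have hNZ : N * Z ^ q ≤ C ^ q := by
    rw [hN]
    unfold wnormE
    simp only [ENNReal.iSup_mul]
    refine iSup_le fun τ => iSup_le fun hτ => ?_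
    have ht : 0 < τ ^ (1 / q) := Real.rpow_pos_of_pos hτ _
    have htq : (τ ^ (1 / q)) ^ q = τ := by
      rw [← Real.rpow_mul hτ.le, one_div_mul_cancel hq0.ne', Real.rpow_one]
    have hsub : {x | ENNReal.ofReal τ < B.indicator (fun x => ENNReal.ofReal (w x ^ q)) x} ⊆
        B ∩ {x | τ ^ (1 / q) < w x} := by
      intro x hx
      simp only [mem_ofPred_eq] at hx
      by_cases hxB : x ∈ B
      · refine ⟨hxB, ?_⟩
        rw [indicator_of_mem hxB] at hx
        have hx' := lt_of_not_ge fun hle => hx.not_ge (ENNReal.ofReal_le_ofReal hle)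
        by_contra hcon
        simp only [mem_ofPred_eq, not_lt] at hcon
        have := Real.rpow_le_rpow (hw0 x) hcon hq0.le
        rw [htq] at this
        linarith
      · rw [indicator_of_notMem hxB] at hx
        exact absurd hx (by simp)
    have h1 := hloc _ ht
    calc _ ≤ ENNReal.ofReal τ * volume (B ∩ {x | τ ^ (1 / q) < w x}) * Z ^ q := by
          rw [div_one, ENNReal.rpow_one]
          gcongr
      _ = (ENNReal.ofReal (τ ^ (1 / q)) * volume (B ∩ {x | τ ^ (1 / q) < w x}) ^ (1 / q) * Z) ^ q := by
          rw [ENNReal.mul_rpow_of_nonneg _ _ hq0.le, ENNReal.mul_rpow_of_nonneg _ _ hq0.le,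
            ← ENNReal.rpow_mul, one_div_mul_cancel hq0.ne', ENNReal.rpow_one,
            ENNReal.ofReal_rpow_of_nonneg ht.le hq0.le, htq]
      _ ≤ C ^ q := by
          gcongr
          rw [hZ, ← mul_assoc]
          exact h1
  have : (V⁻¹ * N) ^ (1 / q) * (V⁻¹ * S) ^ (1 - 1 / p) = (N * Z ^ q) ^ (1 / q) := by
    have hVV : V ^ (β - 1) = (V⁻¹) ^ (1 / q) * (V⁻¹) ^ (1 - 1 / p) := by
      rw [hβ, sub_eq_add_neg, ENNReal.rpow_add _ _ hV0 hVt, ENNReal.rpow_neg, ENNReal.rpow_neg,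
        ENNReal.inv_rpow, ENNReal.inv_rpow]
    rw [ENNReal.mul_rpow_of_nonneg _ _ hq1.le, ENNReal.mul_rpow_of_nonneg _ _ h1p.le,
      ENNReal.mul_rpow_of_nonneg _ _ hq1.le, ← ENNReal.rpow_mul, mul_one_div_cancel hq0.ne',
      ENNReal.rpow_one, hZ, hVV]
    ring
  rw [this]
  calc (N * Z ^ q) ^ (1 / q) ≤ (C ^ q) ^ (1 / q) := by gcongr
    _ = C := by rw [← ENNReal.rpow_mul, mul_one_div_cancel hq0.ne', ENNReal.rpow_one]

/-- For `n ≥ 1`, `0 < α < n`, `1 < p < n/α`, `1/p - 1/q = α/n` and a weight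
`w` on `ℝⁿ`, the multiplier weak-type inequality `‖w·M_α f‖_{L^{q,∞}} ≤ C·‖f‖_{L^p(w^p)}`
holds for all `f ∈ L^p(w^p)` for some `C > 0` if and only if `w ∈ A_{p,q}^*`. -/
theorem statement1 (n : ℕ) (hn : 1 ≤ n) (α : ℝ) (hα : 0 < α) (hαn : α < (n : ℝ))
    (p : ℝ) (hp : 1 < p) (hpn : p < (n : ℝ) / α) (q : ℝ)
    (hq : 1 / p - 1 / q = α / (n : ℝ))
    (w : (Fin n → ℝ) → ℝ) (hwm : Measurable w) (hw0 : ∀ x, 0 ≤ w x)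
    (hwpos : ∀ᵐ x ∂(volume : Measure (Fin n → ℝ)), 0 < w x) :
    (∃ C : ℝ, 0 < C ∧ ∀ f : (Fin n → ℝ) → ℝ, Measurable f →
        (∫⁻ x, ENNReal.ofReal (|f x| ^ p * w x ^ p)) < ∞ →
        wnormE n q (fun x => ENNReal.ofReal (w x) * fracMaximalFn n α f x) ≤
          ENNReal.ofReal C * (∫⁻ x, ENNReal.ofReal (|f x| ^ p * w x ^ p)) ^ (1 / p)) ↔
      ApqStarConst n p q w < ∞ := by
  have hn0 : 0 < (n : ℝ) := by exact_mod_cast hn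
  have hp0 : 0 < p := by linarith
  have hβ0 : 0 < α / (n : ℝ) := by positivity
  have hβ1 : α / (n : ℝ) < 1 := by rw [div_lt_one hn0]; exact hαn
  have hqi : 0 < 1 / q := by
    have : α / (n : ℝ) < 1 / p := by
      rw [lt_div_iff₀ hα] at hpn
      rw [div_lt_div_iff₀ hn0 hp0]
      linarith
    linarith
  have hq0 : 0 < q := one_div_pos.1 hqi
  have hpq : p ≤ q := (one_div_le_one_div hq0 hp0).1 (by linarith)
  simp only [frac_eq]
  constructor
  · rintro ⟨C, hC, h⟩
    refine (nec n (α / n) p q hp hq0 (by linarith) w hwm hw0 hwpos (ENNReal.ofReal C)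
      ?_).trans_lt ENNReal.ofReal_lt_top
    intro f hf hI t ht
    refine le_trans ?_ (h f hf hI)
    unfold wnormE
    exact le_iSup₂ (f := fun (t : ℝ) (_ : 0 < t) => ENNReal.ofReal t * volume {x | ENNReal.ofReal t <
      ENNReal.ofReal (w x) * Mx (α / n) (fun y => ENNReal.ofReal |f y|) x} ^ (1 / q)) t ht
  · intro hS
    obtain ⟨C, hCt, hC⟩ := suff n hn (α / n) p q (q * (1 - 1 / p)) hp hpq rfl hβ0.le hβ1
      (by rw [← hq]; field_simp; ring) w hwm hwpos hS
    refine ⟨(C ^ (1 / q)).toReal + 1, by positivity, fun f hf hI => ?_⟩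
    unfold wnormE
    refine iSup_le fun t => iSup_le fun ht => ?_
    have h1 := ENNReal.rpow_le_rpow (hC f hf t ht) hqi.le
    rw [ENNReal.mul_rpow_of_nonneg _ _ hqi.le, ENNReal.mul_rpow_of_nonneg _ _ hqi.le,
      ← ENNReal.rpow_mul, ← ENNReal.rpow_mul, mul_one_div_cancel hq0.ne', ENNReal.rpow_one,
      show q / p * (1 / q) = 1 / p by field_simp] at h1
    refine h1.trans ?_
    gcongr
    have hCq : C ^ (1 / q) ≠ ∞ := ENNReal.rpow_ne_top_of_nonneg hqi.le hCt
    rw [ENNReal.le_ofReal_iff_toReal_le hCq (by positivity)]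
    linarith
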